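/- arXiv:2308.10106 — 3 statements merged into one kernel-verified Lean document; each statement's English description precedes it below -/
import Mathlib

section
/- Let k ∈ {1,…,d} and let 𝒞 be a finite family of convex sets in ℝ^d. Set m(k,d) = max{d+1, 2(d−k+1)}. If for every subfamily 𝒞* ⊆ 𝒞 of size at most m(k,d) the intersection ⋂𝒞* contains a k-dimensional cone, then ⋂𝒞 contains a k-dimensional cone. -/
open scoped RealInnerProductSpace

/-- The conical hull (set of nonnegative combinations) of a set `V` in `ℝ^d`. -/
def posHull {d : ℕ} (V : Set (EuclideanSpace ℝ (Fin d))) : Set (EuclideanSpace ℝ (Fin d)) :=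
  {x | ∃ (s : Finset (EuclideanSpace ℝ (Fin d))) (c : EuclideanSpace ℝ (Fin d) → ℝ),
    ↑s ⊆ V ∧ (∀ v ∈ s, 0 ≤ c v) ∧ x = ∑ v ∈ s, c v • v}

/-- The lineality set `pos A ∩ (− pos A)` of the conical hull of `A`. -/
def linealitySet {d : ℕ} (A : Set (EuclideanSpace ℝ (Fin d))) : Set (EuclideanSpace ℝ (Fin d)) :=
  posHull A ∩ (-posHull A)

/-- `S` contains a `k`-dimensional cone (with some apex `u`). -/
def ContainsConeDim {d : ℕ} (k : ℕ) (S : Set (EuclideanSpace ℝ (Fin d))) : Prop :=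
  ∃ (u : EuclideanSpace ℝ (Fin d)) (V : Set (EuclideanSpace ℝ (Fin d))),
    Module.finrank ℝ (Submodule.span ℝ V) = k ∧ (fun x => u + x) '' posHull V ⊆ S

section ConeHellyAux

open Module

noncomputable def Dep {τ W : Type*} [AddCommGroup W] [Module ℝ W] (a : τ → W) (T : Finset τ) :
    Submodule ℝ (τ →₀ ℝ) :=
  Finsupp.supported ℝ ℝ (T : Set τ) ⊓ LinearMap.ker (Finsupp.linearCombination ℝ a)

def PosD {τ W : Type*} [AddCommGroup W] [Module ℝ W] (a : τ → W) (T : Finset τ) : Prop :=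
  ∃ l ∈ Dep a T, ∀ i ∈ T, 0 < l i

theorem supported_fd {τ : Type*} (T : Finset τ) :
    FiniteDimensional ℝ (Finsupp.supported ℝ ℝ (T : Set τ)) :=
  LinearEquiv.finiteDimensional (Finsupp.supportedEquivFinsupp (M := ℝ) (R := ℝ) (T : Set τ)).symm

theorem dep_fd {τ W : Type*} [AddCommGroup W] [Module ℝ W] (a : τ → W) (T : Finset τ) :
    FiniteDimensional ℝ (Dep a T) := by
  have := supported_fd T
  exact Submodule.finiteDimensional_of_le (inf_le_left : Dep a T ≤ _)

theorem dep_rank {τ W : Type*} [AddCommGroup W] [Module ℝ W] (a : τ → W) (T : Finset τ) :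
    finrank ℝ (Submodule.span ℝ (a '' (T : Set τ))) + finrank ℝ (Dep a T) = T.card := by
  have := supported_fd T
  have h := LinearMap.finrank_range_add_finrank_ker (K := ℝ)
    (V := ↥(Finsupp.supported ℝ ℝ (T : Set τ))) (V₂ := W)
    ((Finsupp.linearCombination ℝ a).domRestrict (Finsupp.supported ℝ ℝ (T : Set τ)))
  have h1 : finrank ℝ (Finsupp.supported ℝ ℝ (T : Set τ)) = T.card := by
    rw [LinearEquiv.finrank_eq (Finsupp.supportedEquivFinsupp (M := ℝ) (R := ℝ) (T : Set τ))]
    simp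
  have h2 : LinearMap.range ((Finsupp.linearCombination ℝ a).domRestrict
      (Finsupp.supported ℝ ℝ (T : Set τ))) = Submodule.span ℝ (a '' (T : Set τ)) := by
    rw [Finsupp.span_image_eq_map_linearCombination, LinearMap.range_domRestrict]
  have h3 : LinearMap.ker ((Finsupp.linearCombination ℝ a).domRestrict
      (Finsupp.supported ℝ ℝ (T : Set τ))) =
      Submodule.comap (Finsupp.supported ℝ ℝ (T : Set τ)).subtype (Dep a T) := by
    ext x
    constructor
    · intro hx
      exact ⟨x.2, hx⟩
    · intro hx
      exact hx.2
  have h4 : finrank ℝ (Submodule.comap (Finsupp.supported ℝ ℝ (T : Set τ)).subtype (Dep a T)) =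
      finrank ℝ (Dep a T) := LinearEquiv.finrank_eq (Submodule.comapSubtypeEquivOfLe
    (inf_le_left : Dep a T ≤ Finsupp.supported ℝ ℝ (T : Set τ)))
  rw [← h4, ← h1, ← h2, ← h3]
  exact h

theorem dep_mem {τ W : Type*} [AddCommGroup W] [Module ℝ W] {a : τ → W} {T : Finset τ}
    {l : τ →₀ ℝ} : l ∈ Dep a T ↔ (∀ i, i ∉ T → l i = 0) ∧ ∑ i ∈ T, l i • a i = 0 := by
  unfold Dep
  rw [Submodule.mem_inf, Finsupp.mem_supported', LinearMap.mem_ker]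
  constructor
  · rintro ⟨h1, h2⟩
    refine ⟨h1, ?_⟩
    rw [Finsupp.linearCombination_apply, Finsupp.sum_of_support_subset (s := T)] at h2
    · exact h2
    · intro i hi
      by_contra hn
      exact (Finsupp.mem_support_iff.1 hi) (h1 i hn)
    · simp
  · rintro ⟨h1, h2⟩
    refine ⟨h1, ?_⟩
    rw [Finsupp.linearCombination_apply, Finsupp.sum_of_support_subset (s := T)]
    · exact h2
    · intro i hi
      by_contra hn
      exact (Finsupp.mem_support_iff.1 hi) (h1 i hn)
    · simp

theorem dep_mono {τ W : Type*} [AddCommGroup W] [Module ℝ W] (a : τ → W) {T S : Finset τ}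
    (h : T ⊆ S) : Dep a T ≤ Dep a S :=
  inf_le_inf_right _ (Finsupp.supported_mono (by exact_mod_cast h))

theorem dep_support {τ W : Type*} [AddCommGroup W] [Module ℝ W] {a : τ → W} {S : Finset τ}
    {l : τ →₀ ℝ} (h : l ∈ Dep a S) : l ∈ Dep a l.support := by
  exact ⟨(Finsupp.mem_supported _ _).2 subset_rfl, h.2⟩

theorem dep_hit {τ W : Type*} [AddCommGroup W] [Module ℝ W] {a : τ → W} {S : Finset τ}
    {l m : τ →₀ ℝ} (hl : l ∈ Dep a S) (hp : ∀ i ∈ S, 0 < l i) (hm : m ∈ Dep a S) (h0 : m ≠ 0) :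
    ∃ t : ℝ, (l + t • m).support ⊂ S ∧ PosD a (l + t • m).support := by
  -- first, a signed version
  have key : ∀ m : τ →₀ ℝ, m ∈ Dep a S → (∃ j ∈ S, m j < 0) →
      ∃ t : ℝ, (l + t • m).support ⊂ S ∧ PosD a (l + t • m).support := by
    intro m hm ⟨j, hj, hj0⟩
    classical
    let N := S.filter (fun i => m i < 0)
    have hN : N.Nonempty := ⟨j, by simp [N, hj, hj0]⟩
    obtain ⟨i0, hi0, hmin⟩ := N.exists_min_image (fun i => l i / (- m i)) hN
    have hi0' : i0 ∈ S ∧ m i0 < 0 := by simpa [N] using hi0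
    set t := l i0 / (- m i0) with ht
    have htpos : 0 < t := div_pos (hp _ hi0'.1) (by linarith [hi0'.2])
    have hnu : l + t • m ∈ Dep a S := Submodule.add_mem _ hl (Submodule.smul_mem _ _ hm)
    have hnn : ∀ i ∈ S, 0 ≤ (l + t • m) i := by
      intro i hi
      simp only [Finsupp.add_apply, Finsupp.smul_apply, smul_eq_mul]
      by_cases hmi : m i < 0
      · have := hmin i (by simp [N, hi, hmi])
        have h2 : t ≤ l i / (- m i) := this
        rw [le_div_iff₀ (by linarith)] at h2
        linarith
      · push Not at hmi
        have := hp i hi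
        positivity
    have hz : (l + t • m) i0 = 0 := by
      simp only [Finsupp.add_apply, Finsupp.smul_apply, smul_eq_mul, ht]
      have : m i0 ≠ 0 := hi0'.2.ne
      field_simp
      ring
    have hsub : (l + t • m).support ⊆ S := by
      intro i hi
      by_contra hn
      exact (Finsupp.mem_support_iff.1 hi) ((dep_mem.1 hnu).1 i hn)
    refine ⟨t, ⟨hsub, fun h => ?_⟩, _, dep_support hnu, ?_⟩
    · exact (Finsupp.mem_support_iff.1 (h hi0'.1)) hz
    · intro i hi
      exact lt_of_le_of_ne (hnn i (hsub hi)) (Ne.symm (Finsupp.mem_support_iff.1 hi))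
  obtain ⟨j, hj⟩ := Finsupp.ne_iff.1 h0
  have hj : m j ≠ 0 := by simpa using hj
  have hjS : j ∈ S := by
    by_contra hn
    exact hj ((dep_mem.1 hm).1 j hn)
  rcases lt_or_gt_of_ne hj with h | h
  · exact key m hm ⟨j, hjS, h⟩
  · obtain ⟨t, ht⟩ := key (-m) (Submodule.neg_mem _ hm) ⟨j, hjS, by simpa using h⟩
    refine ⟨-t, ?_⟩
    have : l + (-t) • m = l + t • (-m) := by simp
    rw [this]
    exact ht

theorem posD_union {τ W : Type*} [DecidableEq τ] [AddCommGroup W] [Module ℝ W] {a : τ → W}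
    {S T : Finset τ} (hS : PosD a S) (hT : PosD a T) : PosD a (S ∪ T) := by
  obtain ⟨l, hl, hl0⟩ := hS
  obtain ⟨m, hm, hm0⟩ := hT
  refine ⟨l + m, Submodule.add_mem _ (dep_mono a Finset.subset_union_left hl)
    (dep_mono a Finset.subset_union_right hm), ?_⟩
  have hl1 : ∀ i, 0 ≤ l i := fun i => by
    by_cases h : i ∈ S
    · exact (hl0 i h).le
    · exact ((dep_mem.1 hl).1 i h).ge
  have hm1 : ∀ i, 0 ≤ m i := fun i => by
    by_cases h : i ∈ T
    · exact (hm0 i h).le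
    · exact ((dep_mem.1 hm).1 i h).ge
  intro i hi
  rw [Finsupp.add_apply]
  rcases Finset.mem_union.1 hi with h | h
  · linarith [hl0 i h, hm1 i]
  · linarith [hm0 i h, hl1 i]

/-- Steinitz type theorem. -/
theorem steinitz {τ W : Type*} [AddCommGroup W] [Module ℝ W] [FiniteDimensional ℝ W]
    (a : τ → W) (n : ℕ) (T : Finset τ) (hT : PosD a T)
    (hn : n ≤ finrank ℝ (Submodule.span ℝ (a '' (T : Set τ)))) :
    ∃ S ⊆ T, S.card ≤ max (finrank ℝ W + 1) (2 * n) ∧ PosD a S ∧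
      n ≤ finrank ℝ (Submodule.span ℝ (a '' (S : Set τ))) := by
  classical
  induction hN : T.card using Nat.strong_induction_on generalizing T with
  | _ N ih =>
  by_cases hcard : T.card ≤ max (finrank ℝ W + 1) (2 * n)
  · exact ⟨T, subset_rfl, hcard, hT, hn⟩
  push Not at hcard
  by_cases hex : ∃ T' ⊂ T, PosD a T' ∧ n ≤ finrank ℝ (Submodule.span ℝ (a '' (T' : Set τ)))
  · obtain ⟨T', hT', h1, h2⟩ := hex
    obtain ⟨S, hS, h⟩ := ih T'.card (by rw [← hN]; exact Finset.card_lt_card hT') T' h1 h2 rfl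
    exact ⟨S, hS.trans hT'.1, h⟩
  exfalso
  push Not at hex
  have := dep_fd a T
  obtain ⟨l, hl, hl0⟩ := hT
  set 𝒯 : Finset (Finset τ) := T.powerset.filter
    (fun X => X ⊂ T ∧ PosD a X ∧ ∀ Y, Y ⊂ T → PosD a Y → X ⊆ Y → Y = X) with h𝒯
  have hmem : ∀ X, X ∈ 𝒯 ↔ (X ⊂ T ∧ PosD a X ∧ ∀ Y, Y ⊂ T → PosD a Y → X ⊆ Y → Y = X) := by
    intro X
    simp only [h𝒯, Finset.mem_filter, Finset.mem_powerset, and_iff_right_iff_imp]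
    exact fun h => h.1.1
  have hmax : ∀ X, X ⊂ T → PosD a X → ∃ Y ∈ 𝒯, X ⊆ Y := by
    intro X hX hXp
    obtain ⟨Y, hXY, hY⟩ := Finset.exists_le_maximal
      (T.powerset.filter (fun X => X ⊂ T ∧ PosD a X)) (a := X)
      (by simp [hX, hXp, hX.1])
    have hY1 : Y ⊂ T ∧ PosD a Y := by
      have := hY.1
      simp only [Finset.mem_filter] at this
      exact this.2
    refine ⟨Y, (hmem Y).2 ⟨hY1.1, hY1.2, fun Z hZ hZp hYZ => ?_⟩, hXY⟩
    have := hY.2 (y := Z) (by simp [hZ, hZp, hZ.1]) hYZ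
    exact subset_antisymm this hYZ
  -- representatives
  have hrep : ∀ X : 𝒯, ∃ i ∈ T, i ∉ X.1 := by
    intro X
    exact Finset.exists_of_ssubset ((hmem X.1).1 X.2).1
  choose r hr1 hr2 using hrep
  have hc : finrank ℝ (Dep a T) ≤ 𝒯.card := by
    let f : (τ →₀ ℝ) →ₗ[ℝ] (𝒯 → ℝ) := LinearMap.pi (fun X => Finsupp.lapply (r X))
    have hinj : Function.Injective (f.domRestrict (Dep a T)) := by
      rintro ⟨m1, hm1⟩ ⟨m2, hm2⟩ hfm
      by_contra hne
      set m := m1 - m2 with hmdef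
      have hm : m ∈ Dep a T := Submodule.sub_mem _ hm1 hm2
      have hne' : m ≠ 0 := fun h => hne (Subtype.ext (sub_eq_zero.1 h))
      obtain ⟨t, ht1, ht2⟩ := dep_hit hl hl0 hm hne'
      obtain ⟨Y, hY, hsub⟩ := hmax _ ht1 ht2
      have h0 : m (r ⟨Y, hY⟩) = 0 := sub_eq_zero.2 (congrFun hfm ⟨Y, hY⟩)
      have h1 : r ⟨Y, hY⟩ ∈ (l + t • m).support := by
        rw [Finsupp.mem_support_iff, Finsupp.add_apply, Finsupp.smul_apply, h0]
        simpa using (hl0 _ (hr1 ⟨Y, hY⟩)).ne'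
      exact hr2 ⟨Y, hY⟩ (hsub h1)
    have := LinearMap.finrank_le_finrank_of_injective hinj
    simpa using this
  have hrk := dep_rank a T
  have hle : finrank ℝ (Submodule.span ℝ (a '' (T : Set τ))) ≤ finrank ℝ W :=
    Submodule.finrank_le _
  have hsmall : ∀ X ∈ 𝒯, X.card + 2 ≤ n + finrank ℝ (Dep a T) := by
    intro X hX
    obtain ⟨hX1, hX2, -⟩ := (hmem X).1 hX
    have h1 := hex X hX1 hX2
    have h2 := dep_rank a X
    have h3 : finrank ℝ (Dep a X) < finrank ℝ (Dep a T) := by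
      apply Submodule.finrank_lt_finrank_of_lt
      refine lt_of_le_of_ne (dep_mono a hX1.1) (fun h => ?_)
      obtain ⟨i, hi, hi'⟩ := Finset.exists_of_ssubset hX1
      rw [← h] at hl
      exact (hl0 i hi).ne' ((dep_mem.1 hl).1 i hi')
    omega
  have hdisj : ∑ X ∈ 𝒯, (T \ X).card ≤ T.card := by
    rw [← Finset.card_biUnion]
    · apply Finset.card_le_card
      intro i hi
      simp only [Finset.mem_biUnion, Finset.mem_sdiff] at hi
      obtain ⟨X, -, hi, -⟩ := hi
      exact hi
    · intro X hX Y hY hXY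
      show Disjoint (T \ X) (T \ Y)
      rw [Finset.disjoint_left]
      intro i hi hi'
      simp only [Finset.mem_sdiff] at hi hi'
      obtain ⟨hX1, hX2, hX3⟩ := (hmem X).1 hX
      obtain ⟨hY1, hY2, hY3⟩ := (hmem Y).1 hY
      have hU : X ∪ Y ⊂ T := by
        refine ⟨Finset.union_subset hX1.1 hY1.1, fun h => ?_⟩
        rcases Finset.mem_union.1 (h hi.1) with h | h
        · exact hi.2 h
        · exact hi'.2 h
      have e1 := hX3 _ hU (posD_union hX2 hY2) Finset.subset_union_left
      have e2 := hY3 _ hU (posD_union hX2 hY2) Finset.subset_union_right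
      exact hXY (e1.symm.trans e2)
  set c := finrank ℝ (Dep a T) with hcdef
  set y := finrank ℝ (Submodule.span ℝ (a '' (T : Set τ))) with hy
  obtain ⟨D, hD⟩ := Nat.exists_eq_add_of_le hn
  have hlow : 𝒯.card * (D + 2) ≤ ∑ X ∈ 𝒯, (T \ X).card := by
    rw [← smul_eq_mul]
    apply Finset.card_nsmul_le_sum
    intro X hX
    have h1 := hsmall X hX
    have h2 := Finset.card_sdiff_add_card_eq_card ((hmem X).1 hX).1.1
    omega
  have h5 : c * (D + 2) ≤ n + D + c := by
    calc c * (D + 2) ≤ 𝒯.card * (D + 2) := Nat.mul_le_mul_right _ hc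
      _ ≤ T.card := hlow.trans hdisj
      _ = _ := by omega
  have hmx := max_lt_iff.1 hcard
  have h6 : 2 ≤ c := by omega
  obtain ⟨c', hc'⟩ := Nat.exists_eq_add_of_le h6
  have h7 : n + 1 ≤ D + c := by omega
  rw [hc'] at h5 h7
  nlinarith [Nat.zero_le (c' * D)]

/-- Circuits. -/
theorem circuit {τ W : Type*} [AddCommGroup W] [Module ℝ W]
    (a : τ → W) (T : Finset τ) (hT : PosD a T) (j : τ) (hj : j ∈ T) :
    ∃ S ⊆ T, j ∈ S ∧ PosD a S ∧
      S.card ≤ finrank ℝ (Submodule.span ℝ (a '' (S : Set τ))) + 1 := by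
  classical
  induction hN : T.card using Nat.strong_induction_on generalizing T with
  | _ N ih =>
  by_cases hex : ∃ T' ⊂ T, PosD a T' ∧ j ∈ T'
  · obtain ⟨T', hT', h1, h2⟩ := hex
    obtain ⟨S, hS, h⟩ := ih T'.card (by rw [← hN]; exact Finset.card_lt_card hT') T' h1 h2 rfl
    exact ⟨S, hS.trans hT'.1, h⟩
  push Not at hex
  refine ⟨T, subset_rfl, hj, hT, ?_⟩
  obtain ⟨l, hl, hl0⟩ := hT
  have hrk := dep_rank a T
  have : finrank ℝ (Dep a T) ≤ 1 := by
    have hle : Dep a T ≤ Submodule.span ℝ {l} := by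
      intro m hm
      by_contra hn
      have hlj : l j ≠ 0 := (hl0 j hj).ne'
      set m' := m - (m j / l j) • l with hm'
      have h1 : m' ∈ Dep a T := Submodule.sub_mem _ hm (Submodule.smul_mem _ _ hl)
      have h2 : m' ≠ 0 := by
        intro h
        apply hn
        rw [Submodule.mem_span_singleton]
        exact ⟨m j / l j, (sub_eq_zero.1 h).symm⟩
      obtain ⟨t, ht1, ht2⟩ := dep_hit hl hl0 h1 h2
      refine hex _ ht1 ht2 ?_
      have h3 : m' j = 0 := by
        simp [hm', div_mul_cancel₀ _ hlj]
      rw [Finsupp.mem_support_iff, Finsupp.add_apply, Finsupp.smul_apply, h3]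
      simpa using hlj
    exact (Submodule.finrank_mono hle).trans
      (finrank_span_singleton (K := ℝ) (v := l) (fun h => (hl0 j hj).ne' (by simp [h]))).le
  omega

theorem farkas {τ E : Type*} [AddCommGroup E] [Module ℝ E] (T : Finset τ)
    (a : τ → Dual ℝ E) (g : Dual ℝ E)
    (h : ∀ x, (∀ i ∈ T, a i x ≤ 0) → g x ≤ 0) :
    ∃ l : τ → ℝ, (∀ i, 0 ≤ l i) ∧ g = ∑ i ∈ T, l i • a i := by
  classical
  induction T using Finset.induction_on generalizing a g with
  | empty =>
    refine ⟨0, by simp, ?_⟩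
    ext x
    have h1 := h x (by simp)
    have h2 := h (-x) (by simp)
    simp only [map_neg] at h2
    simp only [Finset.sum_empty, LinearMap.zero_apply]
    linarith
  | insert k T hk ih =>
    by_cases hx : ∃ x, (∀ i ∈ T, a i x ≤ 0) ∧ 0 < g x
    · obtain ⟨x, hx1, hx2⟩ := hx
      have hkx : 0 < a k x := by
        by_contra hn
        push Not at hn
        have := h x (by simpa using ⟨hn, hx1⟩)
        linarith
      obtain ⟨l, hl0, hl⟩ := ih (fun i => a i - (a i x / a k x) • a k) (g - (g x / a k x) • a k) (by
        intro y hy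
        have := h (y - (a k y / a k x) • x) (by
          intro i hi
          rcases Finset.mem_insert.1 hi with rfl | hi
          · simp only [map_sub, map_smul, smul_eq_mul]
            field_simp
            simp
          · have := hy i hi
            simp only [LinearMap.sub_apply, LinearMap.smul_apply, smul_eq_mul] at this
            simp only [map_sub, map_smul, smul_eq_mul]
            have e : a k y / a k x * a i x = a i x / a k x * a k y := by ring
            linarith)
        simp only [map_sub, map_smul, smul_eq_mul] at this
        simp only [LinearMap.sub_apply, LinearMap.smul_apply, smul_eq_mul]
        have e : a k y / a k x * g x = g x / a k x * a k y := by ring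
        linarith)
      have hco : 0 ≤ g x / a k x - ∑ i ∈ T, l i * (a i x / a k x) := by
        have : ∑ i ∈ T, l i * (a i x / a k x) ≤ 0 := by
          apply Finset.sum_nonpos
          intro i hi
          exact mul_nonpos_of_nonneg_of_nonpos (hl0 i)
            (div_nonpos_of_nonpos_of_nonneg (hx1 i hi) hkx.le)
        have := div_pos hx2 hkx
        linarith
      refine ⟨Function.update l k (g x / a k x - ∑ i ∈ T, l i * (a i x / a k x)), ?_, ?_⟩
      · intro i
        by_cases hik : i = k
        · subst hik; simpa using hco
        · simpa [hik] using hl0 i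
      · rw [Finset.sum_insert hk]
        have : ∑ i ∈ T, Function.update l k (g x / a k x - ∑ i ∈ T, l i * (a i x / a k x)) i • a i
            = ∑ i ∈ T, l i • a i := by
          apply Finset.sum_congr rfl
          intro i hi
          rw [Function.update_of_ne]
          rintro rfl
          exact hk hi
        rw [this]
        have e : g = (g x / a k x) • a k + ∑ i ∈ T, l i • (a i - (a i x / a k x) • a k) := by
          rw [← hl]; simp
        nth_rewrite 1 [e]
        rw [Function.update_self]
        ext y
        simp only [LinearMap.add_apply, LinearMap.smul_apply, LinearMap.sum_apply,
          LinearMap.sub_apply, smul_eq_mul, mul_sub, Finset.sum_sub_distrib, sub_mul,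
          Finset.sum_mul, mul_assoc]
        ring
    · push Not at hx
      obtain ⟨l, hl0, hl⟩ := ih a g hx
      refine ⟨Function.update l k 0, ?_, ?_⟩
      · intro i
        by_cases hik : i = k
        · subst hik; simp
        · simpa [hik] using hl0 i
      · rw [Finset.sum_insert hk, hl]
        simp only [Function.update_self, zero_smul, zero_add]
        apply Finset.sum_congr rfl
        intro i hi
        rw [Function.update_of_ne]
        rintro rfl
        exact hk hi

def Rec {E : Type*} [AddCommGroup E] [Module ℝ E] (S : Set E) : Set E :=
  {v | ∃ u, ∀ t : ℝ, 0 ≤ t → u + t • v ∈ S}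

def CC {E : Type*} [AddCommGroup E] [Module ℝ E] (k : ℕ) (S : Set E) : Prop :=
  k ≤ finrank ℝ (Submodule.span ℝ (Rec S))

def Core {E : Type*} [AddCommGroup E] [Module ℝ E] (S : Set E) : Set E :=
  {p | p ∈ S ∧ ∀ x ∈ S, ∃ δ : ℝ, 0 < δ ∧ p + δ • (p - x) ∈ S}

def IntF {E ι : Type*} (s : Finset ι) (C : ι → Set E) : Set E := {x | ∀ j ∈ s, x ∈ C j}

def IntE {E ι : Type*} (s : Finset ι) (i : ι) (C : ι → Set E) : Set E :=
  {x | ∀ j ∈ s, j ≠ i → x ∈ C j}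

def Crit {E ι : Type*} [AddCommGroup E] [Module ℝ E] (k : ℕ) (s : Finset ι) (C : ι → Set E) :
    Prop :=
  (∀ i ∈ s, Convex ℝ (C i)) ∧ (∀ i ∈ s, CC k (IntE s i C)) ∧ ¬ CC k (IntF s C)

def NoCrit (n : ℕ) : Prop :=
  ∀ (E : Type) [NormedAddCommGroup E] [NormedSpace ℝ E] [FiniteDimensional ℝ E],
    finrank ℝ E = n → ∀ (ι : Type) (s : Finset ι) (C : ι → Set E) (k : ℕ), 1 ≤ k →
    max (n + 1) (2 * (n + 1 - k)) < s.card → ¬ Crit k s C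

theorem rec_mono {E : Type*} [AddCommGroup E] [Module ℝ E] {S T : Set E} (h : S ⊆ T) :
    Rec S ⊆ Rec T := fun _ ⟨u, hu⟩ => ⟨u, fun t ht => h (hu t ht)⟩

theorem CC_mono {E : Type*} [AddCommGroup E] [Module ℝ E] [FiniteDimensional ℝ E] {k : ℕ}
    {S T : Set E} (h : S ⊆ T) (hS : CC k S) : CC k T :=
  le_trans hS (Submodule.finrank_mono (Submodule.span_mono (rec_mono h)))

theorem CC_nonempty {E : Type*} [AddCommGroup E] [Module ℝ E] {k : ℕ} (hk : 1 ≤ k)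
    {S : Set E} (hS : CC k S) : S.Nonempty := by
  by_contra h
  rw [Set.not_nonempty_iff_eq_empty] at h
  subst h
  have : Rec (∅ : Set E) = ∅ := by
    ext v
    refine iff_of_false ?_ (Set.notMem_empty v)
    rintro ⟨u, hu⟩
    exact hu 0 le_rfl
  unfold CC at hS
  rw [this, Submodule.span_empty, finrank_bot] at hS
  omega

theorem core_rec {E : Type*} [AddCommGroup E] [Module ℝ E] {S : Set E} (hS : Convex ℝ S)
    {p v : E} (hp : p ∈ Core S) (hv : v ∈ Rec S) (t : ℝ) (ht : 0 ≤ t) : p + t • v ∈ S := by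
  obtain ⟨u, hu⟩ := hv
  obtain ⟨δ, hδ, hq⟩ := hp.2 u (by simpa using hu 0 le_rfl)
  have h1 := hu (t * (1 + δ) / δ) (by positivity)
  have h2 := hS hq h1 (a := 1 / (1 + δ)) (b := δ / (1 + δ)) (by positivity) (by positivity)
    (by field_simp)
  convert h2 using 1
  match_scalars
  · field_simp
  · field_simp
  · field_simp
    ring

theorem crit_sup {E ι : Type*} [AddCommGroup E] [Module ℝ E] [FiniteDimensional ℝ E] {k : ℕ}
    {s : Finset ι} {C C' : ι → Set E} (h : Crit k s C) (hc : ∀ i ∈ s, Convex ℝ (C' i))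
    (hsub : ∀ i ∈ s, C i ⊆ C' i) (hn : ¬ CC k (IntF s C')) : Crit k s C' :=
  ⟨hc, fun i hi => CC_mono (S := IntE s i C) (T := IntE s i C')
    (fun _ hx j hj hji => hsub j hj (hx j hj hji)) (h.2.1 i hi), hn⟩

theorem CC_sub1 {E : Type*} [AddCommGroup E] [Module ℝ E] [FiniteDimensional ℝ E] {k : ℕ}
    (F : Submodule ℝ E) (x0 : E) (S : Set E) (h : CC k ((fun y : F => x0 + (y : E)) ⁻¹' S)) :
    CC k S := by
  unfold CC at *
  refine h.trans ?_
  rw [← Submodule.finrank_map_subtype_eq F]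
  apply Submodule.finrank_mono
  rw [Submodule.map_span]
  apply Submodule.span_mono
  rintro _ ⟨v, ⟨u, hu⟩, rfl⟩
  refine ⟨x0 + u, fun t ht => ?_⟩
  have := hu t ht
  simp only [Set.mem_preimage, Submodule.coe_add, Submodule.coe_smul] at this
  rw [add_assoc]
  exact this

theorem CC_sub2 {E : Type*} [AddCommGroup E] [Module ℝ E] [FiniteDimensional ℝ E] {k : ℕ}
    (F : Submodule ℝ E) (x0 : E) (S : Set E) (hS : ∀ x ∈ S, x - x0 ∈ F) (h : CC k S) :
    CC k ((fun y : F => x0 + (y : E)) ⁻¹' S) := by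
  unfold CC at *
  refine h.trans ?_
  rw [← Submodule.finrank_map_subtype_eq F]
  apply Submodule.finrank_mono
  rw [Submodule.map_span]
  apply Submodule.span_mono
  rintro v ⟨u, hu⟩
  have h0 := hS _ (hu 0 le_rfl)
  have h1 := hS _ (hu 1 zero_le_one)
  simp only [zero_smul, add_zero, one_smul] at h0 h1
  have hv : v ∈ F := by
    have := F.sub_mem h1 h0
    convert this using 1
    abel
  refine ⟨⟨v, hv⟩, ⟨⟨u - x0, h0⟩, fun t ht => ?_⟩, rfl⟩
  have := hu t ht
  simp only [Set.mem_preimage, Submodule.coe_add, Submodule.coe_smul]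
  convert this using 1
  abel

theorem posD_eq {E ι : Type*} [AddCommGroup E] [Module ℝ E] {b : ι → Dual ℝ E} {I : Finset ι}
    (h : PosD b I) {x x0 : E} (hx : ∀ i ∈ I, b i x ≤ b i x0) : ∀ i ∈ I, b i x = b i x0 := by
  obtain ⟨l, hl, hl0⟩ := h
  have h1 := (dep_mem.1 hl).2
  have h2 : ∑ i ∈ I, l i * (b i x0 - b i x) = 0 := by
    have := congrArg (fun f : Dual ℝ E => f (x0 - x)) h1
    simpa [LinearMap.sum_apply] using this
  have h3 := (Finset.sum_eq_zero_iff_of_nonneg (fun i hi =>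
    mul_nonneg (hl0 i hi).le (sub_nonneg.2 (hx i hi)))).1 h2
  intro i hi
  rcases mul_eq_zero.1 (h3 i hi) with h | h
  · exact absurd h (hl0 i hi).ne'
  · linarith

theorem step {E ι : Type} [NormedAddCommGroup E] [NormedSpace ℝ E] [FiniteDimensional ℝ E]
    (IH : ∀ n < finrank ℝ E, NoCrit n) (k : ℕ) (hk : 1 ≤ k) (s : Finset ι) (C C' : ι → Set E)
    (hN : max (finrank ℝ E + 1) (2 * (finrank ℝ E + 1 - k)) < s.card)
    (hC : Crit k s C) (x0 : E) (hx0 : x0 ∈ IntF s C) (I : Finset ι) (hI : I ⊆ s)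
    (b : ι → Dual ℝ E) (hb : ∀ i ∈ I, ∀ x ∈ C i, b i x ≤ b i x0) (hpos : PosD b I)
    (hcard : I.card ≤ finrank ℝ (Submodule.span ℝ (b '' (I : Set ι))) + 1)
    (hne : ∃ j ∈ I, b j ≠ 0) (h1 : ∀ i ∈ I, C' i = {x | b i x ≤ b i x0})
    (h2 : ∀ i ∈ s, i ∉ I → C' i = C i) : Crit k s C' := by
  classical
  have hsub : ∀ i ∈ s, C i ⊆ C' i := by
    intro i hi x hx
    by_cases hiI : i ∈ I
    · rw [h1 i hiI]; exact hb i hiI x hx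
    · rw [h2 i hi hiI]; exact hx
  have hconv : ∀ i ∈ s, Convex ℝ (C' i) := by
    intro i hi
    by_cases hiI : i ∈ I
    · rw [h1 i hiI]; exact convex_halfSpace_le (b i).isLinear _
    · rw [h2 i hi hiI]; exact hC.1 i hi
  refine crit_sup hC hconv hsub (fun hCC => ?_)
  obtain ⟨i0, hi0, hbi0⟩ := hne
  set F : Submodule ℝ E := (Submodule.span ℝ (b '' (I : Set ι))).dualCoannihilator with hF
  have hFmem : ∀ x, x ∈ F ↔ ∀ i ∈ I, b i x = 0 := by
    intro x
    rw [hF, Submodule.mem_dualCoannihilator]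
    constructor
    · intro h i hi
      exact h _ (Submodule.subset_span ⟨i, hi, rfl⟩)
    · intro h φ hφ
      induction hφ using Submodule.span_induction with
      | mem y hy => obtain ⟨i, hi, rfl⟩ := hy; exact h i hi
      | zero => simp
      | add y z _ _ hy hz => simp [hy, hz]
      | smul c y _ hy => simp [hy]
  have hrF : finrank ℝ (Submodule.span ℝ (b '' (I : Set ι))) + finrank ℝ F = finrank ℝ E :=
    Subspace.finrank_add_finrank_dualCoannihilator_eq _
  have hr1 : 1 ≤ finrank ℝ (Submodule.span ℝ (b '' (I : Set ι))) := by
    rw [Submodule.one_le_finrank_iff, Submodule.ne_bot_iff]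
    exact ⟨b i0, Submodule.subset_span ⟨i0, hi0, rfl⟩, hbi0⟩
  have hIF : ∀ x, (∀ i ∈ I, x ∈ C i) → x - x0 ∈ F := by
    intro x hx
    rw [hFmem]
    intro i hi
    rw [map_sub, sub_eq_zero]
    exact posD_eq hpos (fun i hi => hb i hi x (hx i hi)) i hi
  set φ : F → E := fun y => x0 + (y : E) with hφ
  have hconvφ : ∀ S : Set E, Convex ℝ S → Convex ℝ (φ ⁻¹' S) := by
    intro S hS x hx y hy a c ha hc hac
    have := hS hx hy ha hc hac
    simp only [Set.mem_preimage, hφ, Submodule.coe_add, Submodule.coe_smul] at this ⊢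
    convert this using 1
    have hc' : c = 1 - a := by linarith
    subst hc'
    module
  let D : ι → Set F := fun j => if j ∈ I then φ ⁻¹' (IntF I C) else φ ⁻¹' (C j)
  have hD1 : ∀ j ∈ I, D j = φ ⁻¹' (IntF I C) := fun j hj => if_pos hj
  have hD2 : ∀ j, j ∉ I → D j = φ ⁻¹' (C j) := fun j hj => if_neg hj
  have hi0' : i0 ∉ s \ I := by simp [hi0]
  have hc1 := Finset.card_insert_of_notMem hi0'
  have hc2 := Finset.card_sdiff_add_card_eq_card hI
  have hmx := max_lt_iff.1 hN
  refine IH (finrank ℝ F) (by omega) F rfl ι (insert i0 (s \ I)) D k hk (max_lt (by omega)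
    (by omega)) ⟨?_, ?_, ?_⟩
  · intro i hi
    by_cases hiI : i ∈ I
    · rw [hD1 i hiI]
      apply hconvφ
      intro x hx y hy a c ha hc hac j hj
      exact hC.1 j (hI hj) (hx j hj) (hy j hj) ha hc hac
    · rw [hD2 i hiI]
      apply hconvφ
      apply hC.1
      rcases Finset.mem_insert.1 hi with rfl | h
      · exact absurd hi0 hiI
      · exact (Finset.mem_sdiff.1 h).1
  · intro i hi
    rcases Finset.mem_insert.1 hi with rfl | h
    · have := CC_sub2 F x0 (IntF s C') (fun x hx => by
        rw [hFmem]
        intro i hi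
        rw [map_sub, sub_eq_zero]
        exact posD_eq hpos (fun i hi => by simpa [h1 i hi] using hx i (hI hi)) i hi) hCC
      refine CC_mono ?_ this
      intro y hy j hj hji
      have hj' : j ∈ s \ I := by
        rcases Finset.mem_insert.1 hj with h | h
        · exact absurd h hji
        · exact h
      rw [Finset.mem_sdiff] at hj'
      rw [hD2 j hj'.2, ← h2 j hj'.1 hj'.2]
      exact hy j hj'.1
    · rw [Finset.mem_sdiff] at h
      have hnI : ∀ j ∈ I, j ≠ i := fun j hj hji => h.2 (hji ▸ hj)
      have := CC_sub2 F x0 (IntE s i C) (fun x hx => hIF x (fun j hj =>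
        hx j (hI hj) (hnI j hj))) (hC.2.1 i h.1)
      refine CC_mono ?_ this
      intro y hy j hj hji
      by_cases hjI : j ∈ I
      · rw [hD1 j hjI]
        intro j' hj'
        exact hy j' (hI hj') (hnI j' hj')
      · rw [hD2 j hjI]
        refine hy j ?_ hji
        rcases Finset.mem_insert.1 hj with rfl | h
        · exact absurd hi0 hjI
        · exact (Finset.mem_sdiff.1 h).1
  · intro h
    refine hC.2.2 (CC_sub1 F x0 _ (CC_mono ?_ h))
    intro y hy j hj
    by_cases hjI : j ∈ I
    · have := hy i0 (Finset.mem_insert_self _ _)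
      rw [hD1 i0 hi0] at this
      exact this j hjI
    · have := hy j (Finset.mem_insert_of_mem (Finset.mem_sdiff.2 ⟨hj, hjI⟩))
      rw [hD2 j hjI] at this
      exact this

theorem sep_single {V : Type*} [NormedAddCommGroup V] [NormedSpace ℝ V] [FiniteDimensional ℝ V]
    (X D : Set V) (hX : Convex ℝ X) (h0 : (0 : V) ∈ X) (hD0 : (0 : V) ∈ D)
    (hDadd : ∀ x ∈ D, ∀ y ∈ D, x + y ∈ D) (hDsmul : ∀ x ∈ D, ∀ t : ℝ, 0 ≤ t → t • x ∈ D)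
    (hdisj : ∀ p ∈ Core X, p ∉ D) :
    ∃ g : Dual ℝ V, (∀ x ∈ X, g x ≤ 0) ∧ (∀ y ∈ D, y ∈ Submodule.span ℝ X → 0 ≤ g y) ∧
      ∃ x ∈ X, g x < 0 := by
  set U := Submodule.span ℝ X with hU
  set X' : Set U := (fun u : U => (u : V)) ⁻¹' X with hX'
  set D' : Set U := (fun u : U => (u : V)) ⁻¹' D with hD'
  have hX'c : Convex ℝ X' := by
    intro x hx y hy a c ha hc hac
    exact hX hx hy ha hc hac
  have hD'c : Convex ℝ D' := by
    intro x hx y hy a c ha hc hac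
    exact hDadd _ (hDsmul _ hx a ha) _ (hDsmul _ hy c hc)
  have h0' : (0 : U) ∈ X' := h0
  have hspan : Submodule.span ℝ X' = ⊤ := Submodule.span_span_coe_preimage
  have haff : affineSpan ℝ X' = ⊤ := by
    rw [AffineSubspace.affineSpan_eq_top_iff_vectorSpan_eq_top_of_nonempty ℝ U U ⟨0, h0'⟩,
      vectorSpan_eq_span_vsub_set_right ℝ h0']
    simpa using hspan
  have hint : (interior X').Nonempty := hX'c.interior_nonempty_iff_affineSpan_eq_top.2 haff
  have hcore : ∀ p ∈ interior X', (p : V) ∈ Core X := by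
    intro p hp
    refine ⟨(interior_subset hp : p ∈ X'), fun x hx => ?_⟩
    set x' : U := ⟨x, Submodule.subset_span hx⟩
    have hcont : Continuous (fun δ : ℝ => p + δ • (p - x')) := by fun_prop
    have hnhds : (fun δ : ℝ => p + δ • (p - x')) ⁻¹' (interior X') ∈ nhds (0 : ℝ) := by
      apply hcont.continuousAt.preimage_mem_nhds
      apply isOpen_interior.mem_nhds
      simpa using hp
    obtain ⟨ε, hε, hball⟩ := Metric.mem_nhds_iff.1 hnhds
    have hm : ε / 2 ∈ Metric.ball (0 : ℝ) ε := by
      rw [Metric.mem_ball, dist_zero_right, Real.norm_eq_abs, abs_of_pos (by linarith)]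
      linarith
    have := interior_subset (hball hm)
    exact ⟨ε / 2, by linarith, this⟩
  have hdisj' : Disjoint (interior X') D' := by
    rw [Set.disjoint_left]
    intro p hp hpD
    exact hdisj _ (hcore p hp) hpD
  obtain ⟨f, u, hf1, hf2⟩ := geometric_hahn_banach_open hX'c.interior isOpen_interior hD'c hdisj'
  have hu0 : u ≤ 0 := by
    have := hf2 0 (by exact hD0)
    simpa using this
  have hfX : ∀ x ∈ X', f x ≤ 0 := by
    intro x hx
    have h1 : x ∈ closure (interior X') := by
      rw [hX'c.closure_interior_eq_closure_of_nonempty_interior hint]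
      exact subset_closure hx
    have h2 : closure (interior X') ⊆ {x | f x ≤ 0} := by
      apply closure_minimal
      · intro y hy
        exact ((hf1 y hy).trans_le hu0).le
      · exact isClosed_le f.continuous continuous_const
    exact h2 h1
  have hfD : ∀ y ∈ D', 0 ≤ f y := by
    intro y hy
    by_contra hn
    push Not at hn
    have := hf2 (((u - 1) / f y) • y) (hDsmul _ hy _ (div_nonneg_of_nonpos (by linarith) hn.le))
    rw [map_smul, smul_eq_mul, div_mul_cancel₀ _ hn.ne] at this
    linarith
  obtain ⟨g, hg⟩ := LinearMap.exists_extend (f : U →ₗ[ℝ] ℝ)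
  have hgf : ∀ u : U, g u = f u := fun u => congrArg (fun h : U →ₗ[ℝ] ℝ => h u) hg
  refine ⟨g, ?_, ?_, ?_⟩
  · intro x hx
    have := hfX ⟨x, Submodule.subset_span hx⟩ hx
    rw [← hgf] at this
    exact this
  · intro y hy hyU
    have := hfD ⟨y, hyU⟩ hy
    rw [← hgf] at this
    exact this
  · obtain ⟨p, hp⟩ := hint
    refine ⟨p, (interior_subset hp : p ∈ X'), ?_⟩
    rw [hgf]
    exact (hf1 p hp).trans_le hu0

theorem separation {E ι : Type*} [NormedAddCommGroup E] [NormedSpace ℝ E] [FiniteDimensional ℝ E]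
    (s M : Finset ι) (hM : M ⊆ s) (C : ι → Set E) (hC : ∀ i ∈ M, Convex ℝ (C i)) (x0 : E)
    (hx0 : ∀ i ∈ M, x0 ∈ C i) (a : ι → Dual ℝ E)
    (ha : ∀ i ∈ s, i ∉ M → C i = {x | a i x ≤ a i x0})
    (hno : ∀ p, (∀ i ∈ M, p ∈ Core (C i)) → ∃ i ∈ s, i ∉ M ∧ ¬ (a i p ≤ a i x0)) :
    ∃ b : ι → Dual ℝ E, (∀ i ∈ s, ∀ x ∈ C i, b i x ≤ b i x0) ∧ ∑ i ∈ s, b i = 0 ∧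
      ∃ j ∈ M, b j ≠ 0 := by
  classical
  set X : Set (M → E) := {y | ∀ i : M, x0 + y i ∈ C i} with hX
  set D : Set (M → E) := {y | ∃ z : E, (∀ i ∈ s, i ∉ M → a i z ≤ 0) ∧ y = fun _ => z} with hD
  have hsingle : ∀ (i : M) (x : E), x0 + x ∈ C i → (Pi.single i x : M → E) ∈ X := by
    intro i x hx j
    by_cases hij : j = i
    · subst hij; simpa using hx
    · rw [Pi.single_eq_of_ne hij]
      simpa using hx0 j j.2
  obtain ⟨g, hg1, hg2, x, hxX, hgx⟩ := sep_single X D (by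
      intro x hx y hy α β hα hβ hab i
      have := hC i i.2 (hx i) (hy i) hα hβ hab
      convert this using 1
      simp only [Pi.add_apply, Pi.smul_apply]
      have : β = 1 - α := by linarith
      subst this
      module)
    (by intro i; simpa using hx0 i i.2) ⟨0, by simp, rfl⟩
    (by
      rintro _ ⟨z, hz, rfl⟩ _ ⟨w, hw, rfl⟩
      refine ⟨z + w, fun i hi hiM => ?_, rfl⟩
      rw [map_add]
      linarith [hz i hi hiM, hw i hi hiM])
    (by
      rintro _ ⟨z, hz, rfl⟩ t ht
      refine ⟨t • z, fun i hi hiM => ?_, rfl⟩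
      rw [map_smul, smul_eq_mul]
      exact mul_nonpos_of_nonneg_of_nonpos ht (hz i hi hiM))
    (by
      rintro p hp ⟨z, hz, rfl⟩
      obtain ⟨i, hi, hiM, hn⟩ := hno (x0 + z) (by
        intro i hi
        refine ⟨hp.1 ⟨i, hi⟩, fun x hx => ?_⟩
        obtain ⟨δ, hδ, h⟩ := hp.2 _ (hsingle ⟨i, hi⟩ (x - x0) (by simpa using hx))
        refine ⟨δ, hδ, ?_⟩
        have := h ⟨i, hi⟩
        simp only [Pi.add_apply, Pi.smul_apply, Pi.sub_apply, Pi.single_eq_same] at this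
        convert this using 1
        module)
      apply hn
      rw [map_add]
      linarith [hz i hi hiM])
  let G : M → Dual ℝ E := fun i => g ∘ₗ LinearMap.single ℝ (fun _ : M => E) i
  have hGap : ∀ i x, G i x = g (Pi.single i x) := fun i x => rfl
  have hgsum : ∀ y : M → E, g y = ∑ i, G i (y i) := by
    intro y
    conv_lhs => rw [← Finset.univ_sum_single y]
    rw [map_sum]
    rfl
  set U : M → Submodule ℝ E := fun i => Submodule.span ℝ {y | x0 + y ∈ C i} with hU
  have hUX : ∀ i, ∀ z ∈ U i, (Pi.single i z : M → E) ∈ Submodule.span ℝ X := by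
    intro i z hz
    have : U i ≤ (Submodule.span ℝ X).comap (LinearMap.single ℝ (fun _ : M => E) i) := by
      rw [hU, Submodule.span_le]
      intro y hy
      exact Submodule.subset_span (hsingle i y hy)
    exact this hz
  set W := ⨅ i, U i with hW
  obtain ⟨l, hl0, hl⟩ := farkas (s \ M) (fun i => (a i) ∘ₗ W.subtype)
    ((-∑ i, G i) ∘ₗ W.subtype) (by
      rintro ⟨z, hz⟩ hza
      have hz' : ∀ i, z ∈ U i := by
        rw [hW, Submodule.mem_iInf] at hz
        exact hz
      have h1 : (fun _ => z : M → E) ∈ Submodule.span ℝ X := by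
        rw [← Finset.univ_sum_single (fun _ => z : M → E)]
        exact Submodule.sum_mem _ (fun i _ => hUX i z (hz' i))
      have h2 := hg2 _ ⟨z, fun i hi hiM => hza i (Finset.mem_sdiff.2 ⟨hi, hiM⟩), rfl⟩ h1
      rw [hgsum] at h2
      simp only [LinearMap.comp_apply, Submodule.subtype_apply, LinearMap.neg_apply,
        LinearMap.sum_apply]
      linarith)
  have hann : (-∑ i, G i) - ∑ i ∈ s \ M, l i • a i ∈ W.dualAnnihilator := by
    rw [Submodule.mem_dualAnnihilator]
    intro w hw
    have := congrArg (fun f : Dual ℝ W => f ⟨w, hw⟩) hl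
    simp only [LinearMap.comp_apply, Submodule.subtype_apply, LinearMap.neg_apply,
        LinearMap.sum_apply, LinearMap.smul_apply] at this
    simp only [LinearMap.sub_apply, LinearMap.neg_apply, LinearMap.sum_apply,
      LinearMap.smul_apply]
    linarith
  rw [hW, Subspace.dualAnnihilator_iInf_eq, Submodule.mem_iSup_iff_exists_finsupp] at hann
  obtain ⟨h, hh1, hh2⟩ := hann
  rw [Finsupp.sum_fintype _ _ (fun _ => rfl)] at hh2
  let b : ι → Dual ℝ E := fun i => if hi : i ∈ M then G ⟨i, hi⟩ + h ⟨i, hi⟩ else l i • a i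
  have hb1 : ∀ i : M, b i = G i + h i := fun i => dif_pos i.2
  have hb2 : ∀ i, i ∉ M → b i = l i • a i := fun i hi => dif_neg hi
  have hbx : ∀ (i : M) (y : E), x0 + y ∈ C i → b i y = G i y := by
    intro i y hy
    rw [hb1, LinearMap.add_apply]
    have := (Submodule.mem_dualAnnihilator _).1 (hh1 i) y (Submodule.subset_span hy)
    rw [this, add_zero]
  refine ⟨b, ?_, ?_, ?_⟩
  · intro i hi x hx
    by_cases hiM : i ∈ M
    · have h1 := hbx ⟨i, hiM⟩ (x - x0) (by simpa using hx)
      have h2 := hg1 _ (hsingle ⟨i, hiM⟩ (x - x0) (by simpa using hx))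
      rw [← hGap, ← h1, map_sub] at h2
      simp only at h2
      linarith
    · rw [hb2 i hiM]
      rw [ha i hi hiM] at hx
      exact mul_le_mul_of_nonneg_left hx (hl0 i)
  · rw [← Finset.sum_sdiff hM, ← Finset.sum_coe_sort M b, Finset.sum_congr rfl (fun i _ => hb1 i),
      Finset.sum_add_distrib, hh2,
      Finset.sum_congr rfl (fun i hi => hb2 i (Finset.mem_sdiff.1 hi).2)]
    abel
  · by_contra hn
    push Not at hn
    rw [hgsum] at hgx
    have : ∑ i, G i (x i) = 0 := by
      apply Finset.sum_eq_zero
      intro i _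
      rw [← hbx i (x i) (hxX i), hn i i.2]
      rfl
    linarith

theorem phase1_aux {E ι : Type} [NormedAddCommGroup E] [NormedSpace ℝ E] [FiniteDimensional ℝ E]
    (IH : ∀ n < finrank ℝ E, NoCrit n) (k : ℕ) (hk : 1 ≤ k) (s : Finset ι)
    (hN : max (finrank ℝ E + 1) (2 * (finrank ℝ E + 1 - k)) < s.card) (x0 : E) :
    ∀ (n : ℕ) (C : ι → Set E) (M : Finset ι) (a : ι → Dual ℝ E), M.card = n → M ⊆ s →
      Crit k s C → x0 ∈ IntF s C → (∀ i ∈ s, i ∉ M → C i = {x | a i x ≤ a i x0}) →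
    ∃ (C' : ι → Set E) (M' : Finset ι) (a' : ι → Dual ℝ E) (p : E), M' ⊆ M ∧ Crit k s C' ∧
      x0 ∈ IntF s C' ∧ (∀ i ∈ M', C' i = C i) ∧
      (∀ i ∈ s, i ∉ M' → C' i = {x | a' i x ≤ a' i x0}) ∧ (∀ i ∈ M', p ∈ Core (C' i)) ∧
      p ∈ IntF s C' := by
  classical
  intro n
  induction n using Nat.strong_induction_on with
  | _ n ih =>
  intro C M a hMn hM hC hx0 ha
  by_cases hp : ∃ p, (∀ i ∈ M, p ∈ Core (C i)) ∧ ∀ i ∈ s, i ∉ M → a i p ≤ a i x0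
  · obtain ⟨p, hp1, hp2⟩ := hp
    refine ⟨C, M, a, p, subset_rfl, hC, hx0, fun _ _ => rfl, ha, hp1, ?_⟩
    intro i hi
    by_cases hiM : i ∈ M
    · exact (hp1 i hiM).1
    · rw [ha i hi hiM]
      exact hp2 i hi hiM
  push Not at hp
  obtain ⟨b, hb1, hb2, j, hjM, hj⟩ := separation s M hM C (fun i hi => hC.1 i (hM hi)) x0
    (fun i hi => hx0 i (hM hi)) a ha (fun p hp1 => by
      obtain ⟨i, hi, hiM, h⟩ := hp p hp1
      exact ⟨i, hi, hiM, not_le.2 h⟩)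
  have hpos : PosD b s := by
    refine ⟨Finsupp.indicator s (fun _ _ => 1), dep_mem.2 ⟨?_, ?_⟩, ?_⟩
    · intro i hi
      exact Finsupp.indicator_of_notMem hi _
    · rw [← hb2]
      apply Finset.sum_congr rfl
      intro i hi
      rw [Finsupp.indicator_of_mem hi, one_smul]
    · intro i hi
      rw [Finsupp.indicator_of_mem hi]
      exact one_pos
  obtain ⟨I, hIs, hjI, hIpos, hIcard⟩ := circuit b s hpos j (hM hjM)
  set C1 : ι → Set E := fun i => if i ∈ I then {x | b i x ≤ b i x0} else C i with hC1
  have h1 : ∀ i ∈ I, C1 i = {x | b i x ≤ b i x0} := fun i hi => if_pos hi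
  have h2 : ∀ i, i ∉ I → C1 i = C i := fun i hi => if_neg hi
  have hcr : Crit k s C1 := step IH k hk s C C1 hN hC x0 hx0 I hIs b
    (fun i hi => hb1 i (hIs hi)) hIpos hIcard ⟨j, hjI, hj⟩ h1 (fun i _ hi => h2 i hi)
  obtain ⟨C', M', a', p, hM', q1, q2, q3, q4⟩ := ih (M \ I).card (by
      rw [← hMn]
      apply Finset.card_lt_card
      refine ⟨Finset.sdiff_subset, fun h => ?_⟩
      exact (Finset.mem_sdiff.1 (h hjM)).2 hjI) C1 (M \ I) (fun i => if i ∈ I then b i else a i)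
    rfl (Finset.sdiff_subset.trans hM) hcr (by
      intro i hi
      by_cases hiI : i ∈ I
      · rw [h1 i hiI]
        exact le_refl (b i x0)
      · rw [h2 i hiI]
        exact hx0 i hi) (by
      intro i hi hiM
      by_cases hiI : i ∈ I
      · rw [h1 i hiI]
        simp only [if_pos hiI]
      · rw [h2 i hiI]
        simp only [if_neg hiI]
        exact ha i hi (fun h => hiM (Finset.mem_sdiff.2 ⟨h, hiI⟩)))
  refine ⟨C', M', a', p, hM'.trans Finset.sdiff_subset, q1, q2, ?_, q4⟩
  intro i hi
  rw [q3 i hi, h2 i (Finset.mem_sdiff.1 (hM' hi)).2]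

theorem phase1 {E ι : Type} [NormedAddCommGroup E] [NormedSpace ℝ E] [FiniteDimensional ℝ E]
    (IH : ∀ n < finrank ℝ E, NoCrit n) (k : ℕ) (hk : 1 ≤ k) (s : Finset ι)
    (hN : max (finrank ℝ E + 1) (2 * (finrank ℝ E + 1 - k)) < s.card) (x0 : E)
    (C : ι → Set E) (hC : Crit k s C) (hx0 : x0 ∈ IntF s C) :
    ∃ (C' : ι → Set E) (M' : Finset ι) (a' : ι → Dual ℝ E) (p : E), M' ⊆ s ∧ Crit k s C' ∧
      x0 ∈ IntF s C' ∧ (∀ i ∈ M', C' i = C i) ∧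
      (∀ i ∈ s, i ∉ M' → C' i = {x | a' i x ≤ a' i x0}) ∧ (∀ i ∈ M', p ∈ Core (C' i)) ∧
      p ∈ IntF s C' :=
  phase1_aux IH k hk s hN x0 _ C s 0 rfl subset_rfl hC hx0 (fun i hi hn => absurd hi hn)

theorem helly_pt {E ι : Type} [NormedAddCommGroup E] [NormedSpace ℝ E] [FiniteDimensional ℝ E]
    (k : ℕ) (hk : 1 ≤ k) (s : Finset ι) (C : ι → Set E) (hN : finrank ℝ E + 1 < s.card)
    (hC : Crit k s C) : ∃ x0, x0 ∈ IntF s C := by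
  have := Convex.helly_theorem (𝕜 := ℝ) (F := C) (s := s) hN.le hC.1 (by
    intro I hI hIc
    obtain ⟨i, hi, hiI⟩ : ∃ i ∈ s, i ∉ I := by
      by_contra hn
      push Not at hn
      have := Finset.card_le_card (show s ⊆ I from hn)
      omega
    obtain ⟨x, hx⟩ := CC_nonempty hk (hC.2.1 i hi)
    refine ⟨x, ?_⟩
    simp only [Set.mem_iInter]
    intro j hj
    exact hx j (hI hj) (fun h => hiI (h ▸ hj)))
  obtain ⟨x, hx⟩ := this
  simp only [Set.mem_iInter] at hx
  exact ⟨x, hx⟩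

def IsCn {E : Type*} [AddCommGroup E] [Module ℝ E] (K : Set E) : Prop :=
  (0 : E) ∈ K ∧ (∀ x ∈ K, ∀ y ∈ K, x + y ∈ K) ∧ ∀ x ∈ K, ∀ t : ℝ, 0 ≤ t → t • x ∈ K

theorem IsCn.convex {E : Type*} [AddCommGroup E] [Module ℝ E] {K : Set E} (h : IsCn K) :
    Convex ℝ K := fun x hx y hy a b ha hb _ =>
  h.2.1 _ (h.2.2 x hx a ha) _ (h.2.2 y hy b hb)

theorem IsCn.half {E : Type*} [AddCommGroup E] [Module ℝ E] (a : Dual ℝ E) :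
    IsCn {x | a x ≤ 0} := by
  refine ⟨by simp, fun x hx y hy => ?_, fun x hx t ht => ?_⟩
  · have hx : a x ≤ 0 := hx
    have hy : a y ≤ 0 := hy
    show a (x + y) ≤ 0
    rw [map_add]; linarith
  · show a (t • x) ≤ 0
    rw [map_smul, smul_eq_mul]
    exact mul_nonpos_of_nonneg_of_nonpos ht hx

theorem isCn_rec {E : Type*} [AddCommGroup E] [Module ℝ E] {S : Set E} (hS : Convex ℝ S)
    (hne : S.Nonempty) : IsCn (Rec S) := by
  refine ⟨?_, ?_, ?_⟩
  · obtain ⟨u, hu⟩ := hne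
    exact ⟨u, fun t _ => by simpa using hu⟩
  · rintro v ⟨u, hu⟩ w ⟨u', hu'⟩
    refine ⟨(1 / 2 : ℝ) • u + (1 / 2 : ℝ) • u', fun t ht => ?_⟩
    have := hS (hu (2 * t) (by linarith)) (hu' (2 * t) (by linarith)) (a := 1 / 2) (b := 1 / 2)
      (by norm_num) (by norm_num) (by norm_num)
    convert this using 1
    module
  · rintro v ⟨u, hu⟩ t ht
    refine ⟨u, fun r hr => ?_⟩
    rw [smul_smul]
    exact hu _ (mul_nonneg hr ht)

theorem rec_sub_span {E : Type*} [AddCommGroup E] [Module ℝ E] (S : Set E) :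
    Rec S ⊆ Submodule.span ℝ S := by
  rintro v ⟨u, hu⟩
  have h0 := Submodule.subset_span (R := ℝ) (hu 0 le_rfl)
  have h1 := Submodule.subset_span (R := ℝ) (hu 1 zero_le_one)
  have := Submodule.sub_mem _ h1 h0
  simpa using this

theorem CC_span {E : Type*} [AddCommGroup E] [Module ℝ E] [FiniteDimensional ℝ E] {k : ℕ}
    {S : Set E} (h : CC k S) : k ≤ finrank ℝ (Submodule.span ℝ S) :=
  le_trans h (Submodule.finrank_mono (Submodule.span_le.2 (rec_sub_span S)))

theorem rec_half {E : Type*} [AddCommGroup E] [Module ℝ E] {a : Dual ℝ E} {c : ℝ} {v : E}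
    (h : v ∈ Rec {x | a x ≤ c}) : a v ≤ 0 := by
  obtain ⟨u, hu⟩ := h
  by_contra hn
  push Not at hn
  have h0 : a (u + (0 : ℝ) • v) ≤ c := hu 0 le_rfl
  simp only [zero_smul, add_zero] at h0
  have h1 : a (u + ((c - a u + 1) / a v) • v) ≤ c :=
    hu ((c - a u + 1) / a v) (div_nonneg (by linarith) hn.le)
  rw [map_add, map_smul, smul_eq_mul, div_mul_cancel₀ _ hn.ne'] at h1
  linarith

theorem core_span {E : Type*} [AddCommGroup E] [Module ℝ E] {K : Set E} (hK : IsCn K) {p : E}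
    (hp : p ∈ Core K) {y : E} (hy : y ∈ Submodule.span ℝ K) :
    ∃ δ : ℝ, 0 < δ ∧ ∀ δ', 0 < δ' → δ' ≤ δ → p + δ' • y ∈ K := by
  have h1 : ∃ y1 ∈ K, ∃ y2 ∈ K, y = y1 - y2 := by
    induction hy using Submodule.span_induction with
    | mem x hx => exact ⟨x, hx, 0, hK.1, by simp⟩
    | zero => exact ⟨0, hK.1, 0, hK.1, by simp⟩
    | add x z _ _ hx hz =>
      obtain ⟨x1, hx1, x2, hx2, rfl⟩ := hx
      obtain ⟨z1, hz1, z2, hz2, rfl⟩ := hz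
      exact ⟨x1 + z1, hK.2.1 _ hx1 _ hz1, x2 + z2, hK.2.1 _ hx2 _ hz2, by abel⟩
    | smul c x _ hx =>
      obtain ⟨x1, hx1, x2, hx2, rfl⟩ := hx
      rcases le_total 0 c with hc | hc
      · exact ⟨c • x1, hK.2.2 _ hx1 c hc, c • x2, hK.2.2 _ hx2 c hc, by module⟩
      · exact ⟨(-c) • x2, hK.2.2 _ hx2 _ (by linarith), (-c) • x1, hK.2.2 _ hx1 _ (by linarith),
          by module⟩
  obtain ⟨y1, hy1, y2, hy2, rfl⟩ := h1
  obtain ⟨δ, hδ, hd⟩ := hp.2 y2 hy2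
  refine ⟨δ / (1 + δ), by positivity, fun δ' h0 hle => ?_⟩
  have h2 := hK.2.2 _ hd (δ' / δ) (by positivity)
  have h3 := hK.2.2 _ hy1 δ' h0.le
  rw [le_div_iff₀ (by positivity)] at hle
  have h4 : 0 ≤ 1 - δ' * (1 + δ) / δ := by
    rw [sub_nonneg, div_le_one hδ]; exact hle
  have h5 := hK.2.2 _ hp.1 _ h4
  convert hK.2.1 _ h5 _ (hK.2.1 _ h2 _ h3) using 1
  match_scalars
  · field_simp
    ring
  · field_simp
  · field_simp

theorem coann_mem {E ι : Type*} [AddCommGroup E] [Module ℝ E] (b : ι → Dual ℝ E) (I : Finset ι)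
    (x : E) : x ∈ (Submodule.span ℝ (b '' (I : Set ι))).dualCoannihilator ↔
      ∀ i ∈ I, b i x = 0 := by
  rw [Submodule.mem_dualCoannihilator]
  constructor
  · intro h i hi
    exact h _ (Submodule.subset_span ⟨i, hi, rfl⟩)
  · intro h φ hφ
    induction hφ using Submodule.span_induction with
    | mem y hy => obtain ⟨i, hi, rfl⟩ := hy; exact h i hi
    | zero => simp
    | add y z _ _ hy hz => simp [hy, hz]
    | smul c y _ hy => simp [hy]

theorem poly_final {E τ : Type*} [AddCommGroup E] [Module ℝ E] [FiniteDimensional ℝ E]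
    (k : ℕ) (hk : 1 ≤ k) (T : Finset τ) (α : τ → Dual ℝ E)
    (hY : finrank ℝ (Submodule.span ℝ {y : E | ∀ t ∈ T, α t y ≤ 0}) < k) :
    ∃ S ⊆ T, S.card ≤ max (finrank ℝ E + 1) (2 * (finrank ℝ E + 1 - k)) ∧
      finrank ℝ (Submodule.span ℝ {y : E | ∀ t ∈ S, α t y ≤ 0}) < k := by
  classical
  set Y := {y : E | ∀ t ∈ T, α t y ≤ 0} with hYdef
  have hYadd : ∀ x ∈ Y, ∀ y ∈ Y, x + y ∈ Y := by
    intro x hx y hy t ht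
    rw [map_add]
    linarith [hx t ht, hy t ht]
  have hY0 : (0 : E) ∈ Y := by intro t _; simp
  set T0 := T.filter (fun t => ∀ y ∈ Y, α t y = 0) with hT0
  have hmem0 : ∀ t, t ∈ T0 ↔ t ∈ T ∧ ∀ y ∈ Y, α t y = 0 := by
    intro t; rw [hT0, Finset.mem_filter]
  have hpos : PosD α T0 := by
    obtain ⟨l, hl0, hl⟩ := farkas T α (-∑ t ∈ T0, α t) (by
      intro x hx
      have : ∑ t ∈ T0, α t x = 0 := Finset.sum_eq_zero (fun t ht => ((hmem0 t).1 ht).2 x hx)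
      simp [LinearMap.sum_apply, this])
    have hlz : ∀ i ∈ T, i ∉ T0 → l i = 0 := by
      intro i hi hi0
      by_contra hne
      apply hi0
      rw [hmem0]
      refine ⟨hi, fun y hy => ?_⟩
      have h1 := congrArg (fun f : Dual ℝ E => f y) hl
      have h2 : ∑ t ∈ T0, α t y = 0 := Finset.sum_eq_zero (fun t ht => ((hmem0 t).1 ht).2 y hy)
      simp only [LinearMap.neg_apply, LinearMap.sum_apply, h2, LinearMap.smul_apply,
        smul_eq_mul, neg_zero] at h1
      have h3 := (Finset.sum_eq_zero_iff_of_nonpos (fun j hj =>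
        mul_nonpos_of_nonneg_of_nonpos (hl0 j) (hy j hj))).1 h1.symm i hi
      exact (mul_eq_zero.1 h3).resolve_left hne
    have hl' : ∑ i ∈ T, l i • α i = ∑ i ∈ T0, l i • α i := by
      symm
      apply Finset.sum_subset (Finset.filter_subset _ _)
      intro i hi hi0
      rw [hlz i hi hi0, zero_smul]
    refine ⟨Finsupp.indicator T0 (fun i _ => 1 + l i), dep_mem.2 ⟨?_, ?_⟩, ?_⟩
    · intro i hi
      exact Finsupp.indicator_of_notMem hi _
    · have : ∑ i ∈ T0, (Finsupp.indicator T0 (fun i _ => 1 + l i)) i • α i =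
          ∑ i ∈ T0, α i + ∑ i ∈ T0, l i • α i := by
        rw [← Finset.sum_add_distrib]
        apply Finset.sum_congr rfl
        intro i hi
        rw [Finsupp.indicator_of_mem hi]
        ext x
        simp only [LinearMap.smul_apply, LinearMap.add_apply, smul_eq_mul]
        ring
      rw [this, ← hl', ← hl]
      abel
    · intro i hi
      rw [Finsupp.indicator_of_mem hi]
      linarith [hl0 i]
  have hq : ∃ q ∈ Y, ∀ t ∈ T, t ∉ T0 → α t q < 0 := by
    have : ∀ t : τ, ∃ y ∈ Y, t ∈ T → t ∉ T0 → α t y < 0 := by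
      intro t
      by_cases h : t ∈ T ∧ t ∉ T0
      · have h' : ¬ ∀ y ∈ Y, α t y = 0 := fun hh => h.2 ((hmem0 t).2 ⟨h.1, hh⟩)
        push Not at h'
        obtain ⟨y, hy, hne⟩ := h'
        exact ⟨y, hy, fun _ _ => lt_of_le_of_ne (hy t h.1) hne⟩
      · exact ⟨0, hY0, fun h1 h2 => absurd ⟨h1, h2⟩ h⟩
    choose y hy1 hy2 using this
    refine ⟨∑ t ∈ T, y t, ?_, ?_⟩
    · intro t ht
      rw [map_sum]
      exact Finset.sum_nonpos (fun i _ => hy1 i t ht)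
    · intro t ht ht0
      rw [map_sum]
      exact Finset.sum_neg' (fun i _ => hy1 i t ht) ⟨t, ht, hy2 t ht ht0⟩
  obtain ⟨q, hqY, hq⟩ := hq
  have hF : (Submodule.span ℝ (α '' (T0 : Set τ))).dualCoannihilator ≤ Submodule.span ℝ Y := by
    intro x hx
    rw [coann_mem] at hx
    have hev : ∀ᶠ δ in nhdsWithin (0 : ℝ) (Set.Ioi 0), ∀ t ∈ T, α t (q + δ • x) ≤ 0 := by
      rw [Filter.eventually_all_finset]
      intro t ht
      by_cases ht0 : t ∈ T0
      · apply Filter.Eventually.of_forall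
        intro δ
        rw [map_add, map_smul, hx t ht0, ((hmem0 t).1 ht0).2 q hqY]
        simp
      · have hc : Continuous (fun δ : ℝ => α t q + δ * α t x) := by fun_prop
        have := (hc.tendsto 0).eventually_lt_const (u := 0) (by simpa using hq t ht ht0)
        filter_upwards [nhdsWithin_le_nhds this] with δ hδ
        rw [map_add, map_smul, smul_eq_mul]
        exact hδ.le
    obtain ⟨δ, hδ, hδ0⟩ := (hev.and self_mem_nhdsWithin).exists
    have hδ0 : 0 < δ := hδ0
    have h1 : q + δ • x ∈ Submodule.span ℝ Y := Submodule.subset_span hδ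
    have h2 := Submodule.smul_mem _ δ⁻¹ (Submodule.sub_mem _ h1 (Submodule.subset_span hqY))
    rw [add_sub_cancel_left, smul_smul, inv_mul_cancel₀ hδ0.ne', one_smul] at h2
    exact h2
  have hr := Subspace.finrank_add_finrank_dualCoannihilator_eq
    (Submodule.span ℝ (α '' (T0 : Set τ)))
  have hr2 := Submodule.finrank_mono hF
  obtain ⟨S, hS, hSc, hSp, hSr⟩ := steinitz α (finrank ℝ E + 1 - k) T0 hpos (by omega)
  rw [Subspace.dual_finrank_eq] at hSc
  refine ⟨S, hS.trans (Finset.filter_subset _ _), hSc, ?_⟩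
  have hr3 := Subspace.finrank_add_finrank_dualCoannihilator_eq
    (Submodule.span ℝ (α '' (S : Set τ)))
  have hle : Submodule.span ℝ {y : E | ∀ t ∈ S, α t y ≤ 0} ≤
      (Submodule.span ℝ (α '' (S : Set τ))).dualCoannihilator := by
    rw [Submodule.span_le]
    intro y hy
    show y ∈ (Submodule.span ℝ (α '' (S : Set τ))).dualCoannihilator
    rw [coann_mem]
    intro i hi
    have := posD_eq hSp (x := y) (x0 := 0) (fun i hi => by simpa using hy i hi) i hi
    simpa using this
  have hr4 := Submodule.finrank_mono hle
  omega

theorem final {E ι : Type*} [NormedAddCommGroup E] [NormedSpace ℝ E] [FiniteDimensional ℝ E]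
    (k : ℕ) (hk : 1 ≤ k) (s : Finset ι) (K : ι → Set E)
    (hN : max (finrank ℝ E + 1) (2 * (finrank ℝ E + 1 - k)) < s.card)
    (hK : ∀ i ∈ s, IsCn (K i)) (M : Finset ι) (hM : M ⊆ s) (a : ι → Dual ℝ E)
    (ha : ∀ i ∈ s, i ∉ M → K i = {x | a i x ≤ 0}) (p : E) (hp : ∀ i ∈ M, p ∈ Core (K i))
    (hp' : p ∈ IntF s K) : ¬ Crit k s K := by
  classical
  intro hC
  have hB : ∀ i : ι, ∃ B : Finset (Dual ℝ E), i ∈ s → (∀ y ∈ K i, ∀ f ∈ B, f y ≤ 0) ∧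
      ∀ y, (∀ f ∈ B, f y ≤ 0) → ∃ δ : ℝ, 0 < δ ∧ ∀ δ', 0 < δ' → δ' ≤ δ → p + δ' • y ∈ K i := by
    intro i
    by_cases his : i ∈ s
    swap
    · exact ⟨∅, fun h => absurd h his⟩
    by_cases hiM : i ∈ M
    · obtain ⟨B, hB⟩ := IsNoetherian.noetherian (Submodule.span ℝ (K i)).dualAnnihilator
      refine ⟨B ∪ B.image (fun f => -f), fun _ => ⟨?_, ?_⟩⟩
      · intro y hy f hf
        have hz : ∀ g ∈ B, g y = 0 := by
          intro g hg
          have : g ∈ (Submodule.span ℝ (K i)).dualAnnihilator := hB ▸ Submodule.subset_span hg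
          exact (Submodule.mem_dualAnnihilator _).1 this y (Submodule.subset_span hy)
        rcases Finset.mem_union.1 hf with hf | hf
        · exact (hz f hf).le
        · obtain ⟨g, hg, rfl⟩ := Finset.mem_image.1 hf
          simp [hz g hg]
      · intro y hy
        apply core_span (hK i his) (hp i hiM)
        rw [← Subspace.dualAnnihilator_dualCoannihilator_eq (W := Submodule.span ℝ (K i)), ← hB]
        have := coann_mem (fun f : Dual ℝ E => f) B y
        rw [Set.image_id'] at this
        rw [this]
        intro f hf
        have h1 := hy f (Finset.mem_union_left _ hf)
        have h2 := hy (-f) (Finset.mem_union_right _ (Finset.mem_image_of_mem _ hf))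
        simp only [LinearMap.neg_apply] at h2
        linarith
    · refine ⟨{a i}, fun _ => ⟨?_, ?_⟩⟩
      · intro y hy f hf
        rw [ha i his hiM] at hy
        rw [Finset.mem_singleton.1 hf]
        exact hy
      · intro y hy
        refine ⟨1, one_pos, fun δ' h0 _ => (hK i his).2.1 _ (hp' i his) _
          ((hK i his).2.2 _ ?_ _ h0.le)⟩
        rw [ha i his hiM]
        exact hy _ (Finset.mem_singleton_self _)
  choose B hB using hB
  let T : Finset (Σ _ : ι, Dual ℝ E) := s.sigma B
  have hYspan : Submodule.span ℝ {y : E | ∀ t ∈ T, t.2 y ≤ 0} ≤ Submodule.span ℝ (IntF s K) := by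
    rw [Submodule.span_le]
    intro y hy
    have hev : ∀ᶠ δ in nhdsWithin (0 : ℝ) (Set.Ioi 0), ∀ i ∈ s, p + δ • y ∈ K i := by
      rw [Filter.eventually_all_finset]
      intro i hi
      obtain ⟨δ, hδ, h⟩ := (hB i hi).2 y (fun f hf => hy ⟨i, f⟩ (Finset.mem_sigma.2 ⟨hi, hf⟩))
      filter_upwards [Ioc_mem_nhdsGT hδ] with δ' hδ'
      exact h δ' hδ'.1 hδ'.2
    obtain ⟨δ, hδ, hδ0⟩ := (hev.and self_mem_nhdsWithin).exists
    have hδ0 : 0 < δ := hδ0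
    have h1 : p + δ • y ∈ Submodule.span ℝ (IntF s K) := Submodule.subset_span hδ
    have h2 := Submodule.smul_mem _ δ⁻¹ (Submodule.sub_mem _ h1 (Submodule.subset_span hp'))
    rw [add_sub_cancel_left, smul_smul, inv_mul_cancel₀ hδ0.ne', one_smul] at h2
    exact h2
  have hIR : IntF s K ⊆ Rec (IntF s K) := by
    intro v hv
    refine ⟨0, fun t ht i hi => ?_⟩
    rw [zero_add]
    exact (hK i hi).2.2 _ (hv i hi) t ht
  have hlt : finrank ℝ (Submodule.span ℝ {y : E | ∀ t ∈ T, t.2 y ≤ 0}) < k :=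
    lt_of_le_of_lt (Submodule.finrank_mono (hYspan.trans (Submodule.span_mono hIR)))
      (not_le.1 hC.2.2)
  obtain ⟨S, hST, hScard, hSlt⟩ := poly_final k hk T (fun t => t.2) hlt
  obtain ⟨i, hi, hiS⟩ : ∃ i ∈ s, i ∉ S.image Sigma.fst := by
    by_contra hn
    push Not at hn
    have h1 := Finset.card_le_card (show s ⊆ S.image Sigma.fst from hn)
    have h2 := Finset.card_image_le (s := S) (f := Sigma.fst)
    omega
  have h1 := CC_span (hC.2.1 i hi)
  have h2 : finrank ℝ (Submodule.span ℝ (IntE s i K)) ≤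
      finrank ℝ (Submodule.span ℝ {y : E | ∀ t ∈ S, t.2 y ≤ 0}) := by
    apply Submodule.finrank_mono
    apply Submodule.span_mono
    intro x hx t ht
    obtain ⟨ht1, ht2⟩ := Finset.mem_sigma.1 (hST ht)
    exact (hB t.1 ht1).1 x (hx t.1 ht1 (fun h => hiS (h ▸ Finset.mem_image_of_mem _ ht))) _ ht2
  omega

theorem noCrit (n : ℕ) : NoCrit n := by
  induction n using Nat.strong_induction_on with
  | _ n IH =>
  intro E _ _ _ hn ι s C k hk hN hC
  subst hn
  obtain ⟨x0, hx0⟩ := helly_pt k hk s C (max_lt_iff.1 hN).1 hC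
  obtain ⟨C', M, a, p, hMs, hC', hx0', -, hhalf, hcore, hp⟩ := phase1 IH k hk s hN x0 C hC hx0
  set D : ι → Set E := fun i => Rec (C' i) with hD
  have hDc : ∀ i ∈ s, IsCn (D i) := fun i hi => isCn_rec (hC'.1 i hi) ⟨x0, hx0' i hi⟩
  have hDcrit : Crit k s D := by
    refine ⟨fun i hi => (hDc i hi).convex, ?_, ?_⟩
    · intro i hi
      refine le_trans (hC'.2.1 i hi) (Submodule.finrank_mono (Submodule.span_mono ?_))
      intro v hv
      refine ⟨0, fun t ht j hj hji => ?_⟩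
      rw [zero_add]
      refine (hDc j hj).2.2 _ ?_ t ht
      exact rec_mono (S := IntE s i C') (fun x hx => hx j hj hji) hv
    · intro h
      apply hC'.2.2
      refine le_trans (CC_span h) (Submodule.finrank_mono (Submodule.span_mono ?_))
      intro v hv
      refine ⟨p, fun t ht j hj => ?_⟩
      by_cases hjM : j ∈ M
      · exact core_rec (hC'.1 j hj) (hcore j hjM) (hv j hj) t ht
      · have h1 := hv j hj
        have h2 := hp j hj
        simp only [hD] at h1
        rw [hhalf j hj hjM] at h1 h2 ⊢
        have h3 := rec_half h1
        have h2 : a j p ≤ a j x0 := h2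
        show a j (p + t • v) ≤ a j x0
        rw [map_add, map_smul, smul_eq_mul]
        have := mul_nonpos_of_nonneg_of_nonpos ht h3
        linarith
  obtain ⟨D', M', a', p', hMs', hD', -, heq, hhalf', hcore', hp'⟩ :=
    phase1 IH k hk s hN 0 D hDcrit (fun i hi => (hDc i hi).1)
  have hhalf'' : ∀ i ∈ s, i ∉ M' → D' i = {x | a' i x ≤ 0} := by
    intro i hi hiM
    rw [hhalf' i hi hiM, map_zero]
  refine final k hk s D' hN ?_ M' hMs' a' hhalf'' p' hcore' hp' hD'
  intro i hi
  by_cases hiM : i ∈ M'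
  · rw [heq i hiM]; exact hDc i hi
  · rw [hhalf'' i hi hiM]; exact IsCn.half _

theorem CC_of_cone {d k : ℕ} {S : Set (EuclideanSpace ℝ (Fin d))} (h : ContainsConeDim k S) :
    CC k S := by
  obtain ⟨u, V, hV, hS⟩ := h
  unfold CC
  rw [← hV]
  apply Submodule.finrank_mono
  apply Submodule.span_mono
  intro v hv
  refine ⟨u, fun t ht => hS ⟨t • v, ⟨{v}, fun _ => t, by simpa using hv, fun _ _ => ht, by simp⟩,
    rfl⟩⟩

theorem cone_of_CC {d k : ℕ} (hk : 1 ≤ k) {S : Set (EuclideanSpace ℝ (Fin d))}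
    (hS : Convex ℝ S) (h : CC k S) : ContainsConeDim k S := by
  classical
  obtain ⟨b, hb, hspan, hli⟩ := exists_linearIndependent ℝ (Rec S)
  have hfin : b.Finite := hli.setFinite
  have hcard : k ≤ hfin.toFinset.card := by
    have h1 : finrank ℝ (Submodule.span ℝ b) ≤ hfin.toFinset.card := by
      have := finrank_span_finset_le_card (R := ℝ) hfin.toFinset
      rwa [hfin.coe_toFinset] at this
    unfold CC at h
    rw [← hspan] at h
    exact h.trans h1
  obtain ⟨V, hVsub, hVc⟩ := Finset.exists_subset_card_eq hcard
  have hVb : (V : Set (EuclideanSpace ℝ (Fin d))) ⊆ b := by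
    intro v hv
    exact hfin.mem_toFinset.1 (hVsub hv)
  have hVR : ∀ v ∈ V, v ∈ Rec S := fun v hv => hb (hVb hv)
  have hex : ∀ v : EuclideanSpace ℝ (Fin d), ∃ u, v ∈ V → ∀ t : ℝ, 0 ≤ t → u + t • v ∈ S := by
    intro v
    by_cases hv : v ∈ V
    · obtain ⟨u, hu⟩ := hVR v hv
      exact ⟨u, fun _ => hu⟩
    · exact ⟨0, fun h => absurd h hv⟩
  choose u hu using hex
  refine ⟨∑ v ∈ V, (1 / (k : ℝ)) • u v, V, ?_, ?_⟩
  · rw [← hVc]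
    exact finrank_span_finset_eq_card (LinearIndepOn.mono (show LinearIndepOn ℝ id b from hli) hVb)
  · rintro _ ⟨x, ⟨s, c, hs, hc, rfl⟩, rfl⟩
    have hk0 : (0 : ℝ) < k := by exact_mod_cast hk
    have hsV : s ⊆ V := by exact_mod_cast hs
    have hsum : ∑ v ∈ s, c v • v = ∑ v ∈ V, (if v ∈ s then c v else 0) • v := by
      rw [← Finset.sum_subset hsV]
      · apply Finset.sum_congr rfl
        intro v hv
        rw [if_pos hv]
      · intro v _ hv
        rw [if_neg hv, zero_smul]
    have hin : ∑ v ∈ V, (1 / (k : ℝ)) • (u v + (k * (if v ∈ s then c v else 0)) • v) ∈ S := by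
      apply hS.sum_mem
      · intro v _; positivity
      · rw [Finset.sum_const, hVc, nsmul_eq_mul]
        field_simp
      · intro v hv
        apply hu v hv
        split_ifs with h
        · exact mul_nonneg hk0.le (hc v h)
        · simp
    convert hin using 1
    simp only [hsum]
    rw [← Finset.sum_add_distrib]
    apply Finset.sum_congr rfl
    intro v _
    rw [smul_add, smul_smul, ← mul_assoc, one_div_mul_cancel hk0.ne', one_mul]

end ConeHellyAux

/-- Helly-type theorem for `k`-dimensional cones with bound `m(k,d) = max {d+1, 2(d-k+1)}`. -/
theorem cone_helly (d k : ℕ) (hk1 : 1 ≤ k) (hkd : k ≤ d)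
    (𝒞 : Finset (Set (EuclideanSpace ℝ (Fin d))))
    (hconv : ∀ C ∈ 𝒞, Convex ℝ C)
    (H : ∀ 𝒞' ⊆ 𝒞, 𝒞'.card ≤ max (d + 1) (2 * (d - k + 1)) →
      ContainsConeDim k (⋂₀ (𝒞' : Set (Set (EuclideanSpace ℝ (Fin d)))))) :
    ContainsConeDim k (⋂₀ (𝒞 : Set (Set (EuclideanSpace ℝ (Fin d))))) := by
  classical
  suffices h : ∀ n, ∀ 𝒟 ⊆ 𝒞, 𝒟.card = n →
      ContainsConeDim k (⋂₀ (𝒟 : Set (Set (EuclideanSpace ℝ (Fin d))))) from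
    h _ 𝒞 subset_rfl rfl
  intro n
  induction n using Nat.strong_induction_on with
  | _ n ih =>
  intro 𝒟 h𝒟 hn
  by_cases hle : 𝒟.card ≤ max (d + 1) (2 * (d - k + 1))
  · exact H 𝒟 h𝒟 hle
  have hconvI : Convex ℝ (⋂₀ (𝒟 : Set (Set (EuclideanSpace ℝ (Fin d))))) :=
    convex_sInter (fun C hC => hconv C (h𝒟 hC))
  apply cone_of_CC hk1 hconvI
  by_contra hno
  refine noCrit d (EuclideanSpace ℝ (Fin d)) (by simp) (Set (EuclideanSpace ℝ (Fin d))) 𝒟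
    (fun C => C) k hk1 ?_ ⟨fun C hC => hconv C (h𝒟 hC), ?_, ?_⟩
  · have : d - k + 1 = d + 1 - k := by omega
    rw [← this]
    exact not_le.1 hle
  · intro C hC
    have h1 := CC_of_cone (ih (𝒟.erase C).card (by
      rw [← hn]; exact Finset.card_erase_lt_of_mem hC) (𝒟.erase C)
      ((Finset.erase_subset _ _).trans h𝒟) rfl)
    refine CC_mono ?_ h1
    intro x hx B hB hBC
    exact hx B (Finset.mem_coe.2 (Finset.mem_erase.2 ⟨hBC, hB⟩))
  · intro h
    apply hno
    refine CC_mono ?_ h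
    intro x hx B hB
    exact hx B hB
end

section
/- Let k ∈ {1,…,d} and let 𝒞 be a finite family of convex sets in ℝ^d. If for every subfamily 𝒞* ⊆ 𝒞 of size at most k+1 the intersection ⋂𝒞* contains an affine flat of dimension d−k, then ⋂𝒞 contains an affine flat of dimension d−k. -/
lemma dS_stiemke {ι : Type} [Fintype ι] {X : Type} [AddCommGroup X] [Module ℝ X]
    (B : (ι → ℝ) →ₗ[ℝ] X) (U : Submodule ℝ X) :
    (∃ l : ι → ℝ, (∀ i, 0 < l i) ∧ B l ∈ U) ∨
    ∃ φ : X →ₗ[ℝ] ℝ, (∀ x ∈ U, φ x = 0) ∧ (∀ l : ι → ℝ, (∀ i, 0 ≤ l i) → 0 ≤ φ (B l)) ∧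
      ∃ l, φ (B l) ≠ 0 := by
  classical
  by_cases hpos : ∃ l : ι → ℝ, (∀ i, 0 < l i) ∧ B l ∈ U
  · exact Or.inl hpos
  right
  push Not at hpos
  let O : Set (ι → ℝ) := {l | ∀ i, 0 < l i}
  have hO : IsOpen O := by
    have : O = Set.univ.pi (fun _ => Set.Ioi (0:ℝ)) := by
      ext l; simp [O]
    rw [this]
    exact isOpen_set_pi Set.finite_univ (fun _ _ => isOpen_Ioi)
  have hOc : Convex ℝ O := by
    have : O = Set.univ.pi (fun _ => Set.Ioi (0:ℝ)) := by
      ext l; simp [O]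
    rw [this]
    exact convex_pi (fun _ _ => convex_Ioi _)
  let K : Submodule ℝ (ι → ℝ) := U.comap B
  have hdis : Disjoint O (K : Set (ι → ℝ)) := by
    rw [Set.disjoint_left]
    intro l hl hk
    exact hpos l hl hk
  obtain ⟨f, c, hf1, hf2⟩ := geometric_hahn_banach_open hOc hO K.convex hdis
  have hc0 : c ≤ 0 := by simpa using hf2 0 K.zero_mem
  have hfK : ∀ x ∈ K, f x = 0 := by
    intro x hx
    by_contra hne
    have h1 := hf2 (((c - 1) / f x) • x) (K.smul_mem _ hx)
    rw [map_smul, smul_eq_mul, div_mul_cancel₀ _ hne] at h1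
    linarith
  have hneg : ∀ l : ι → ℝ, (∀ i, 0 ≤ l i) → f l ≤ 0 := by
    intro l hl
    by_contra hlt
    push Not at hlt
    have h1 : ∀ ε : ℝ, 0 < ε → f l + ε * f 1 < 0 := by
      intro ε hε
      have := hf1 (l + ε • 1) (fun i => by
        have := hl i
        simp only [Pi.add_apply, Pi.smul_apply, Pi.one_apply, smul_eq_mul, mul_one]; linarith)
      rw [map_add, map_smul, smul_eq_mul] at this
      linarith
    have h2 : f 1 < 0 := by
      have := h1 1 one_pos
      linarith
    have h3 := h1 (f l / (-f 1)) (div_pos hlt (by linarith))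
    have h4 : f l / (-f 1) * f 1 = - f l := by
      have h5 : f 1 ≠ 0 := h2.ne
      rw [div_neg, neg_mul, div_mul_cancel₀ _ h5]
    linarith
  have hker : LinearMap.ker (U.mkQ ∘ₗ B) = K := by
    rw [LinearMap.ker_comp, Submodule.ker_mkQ]
  have hmem : (-(f : (ι → ℝ) →ₗ[ℝ] ℝ)) ∈ LinearMap.range (U.mkQ ∘ₗ B).dualMap := by
    rw [LinearMap.range_dualMap_eq_dualAnnihilator_ker, hker, Submodule.mem_dualAnnihilator]
    intro x hx
    simp [hfK x hx]
  obtain ⟨g, hg⟩ := hmem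
  have hg' : ∀ l, g (U.mkQ (B l)) = - f l := by
    intro l
    have := congrArg (fun q => q l) hg
    simpa using this
  refine ⟨g ∘ₗ U.mkQ, ?_, ?_, ?_⟩
  · intro x hx
    have : U.mkQ x = 0 := by simpa using hx
    rw [LinearMap.comp_apply, this, map_zero]
  · intro l hl
    rw [LinearMap.comp_apply, hg']
    linarith [hneg l hl]
  · refine ⟨1, ?_⟩
    rw [LinearMap.comp_apply, hg']
    have := hf1 1 (fun i => by simp)
    linarith

lemma dS_lattice {I : Type} [Fintype I] (K : Submodule ℝ (I → ℝ))
    (habs : ∀ x ∈ K, |x| ∈ K) :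
    ∃ (J : Type) (_ : Fintype J) (μ : J → I → ℝ), Module.finrank ℝ K ≤ Fintype.card J ∧
      (∀ a, μ a ∈ K) ∧ (∀ a i, 0 ≤ μ a i) ∧ (∀ a, ∃ i, μ a i ≠ 0) ∧
      (∀ a b i, μ a i ≠ 0 → μ b i ≠ 0 → a = b) := by
  classical
  let supp : (I → ℝ) → Finset I := fun x => Finset.univ.filter (fun i => x i ≠ 0)
  have hs : ∀ x i, i ∈ supp x ↔ x i ≠ 0 := by intro x i; simp [supp]
  let Q : Finset I → Prop := fun A => ∃ x ∈ K, x ≠ 0 ∧ supp x = A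
  let J := {A : Finset I // Minimal Q A}
  have hex : ∀ a : J, ∃ x ∈ K, (∀ i, 0 ≤ x i) ∧ x ≠ 0 ∧ supp x = a.1 := by
    rintro ⟨A, hA⟩
    obtain ⟨x, hx, hx0, hxA⟩ := hA.1
    refine ⟨|x|, habs x hx, fun i => abs_nonneg _, by simpa using hx0, ?_⟩
    refine Eq.trans ?_ hxA
    ext i; simp [hs]
  choose μ hK hnn hne hsu using hex
  have hdisj : ∀ a b i, μ a i ≠ 0 → μ b i ≠ 0 → a = b := by
    intro a b i ha hb
    let z : I → ℝ := (1/2 : ℝ) • (μ a + μ b - |μ a - μ b|)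
    have hz : z ∈ K := K.smul_mem _ (K.sub_mem (K.add_mem (hK a) (hK b))
      (habs _ (K.sub_mem (hK a) (hK b))))
    have hzm : ∀ i, z i = min (μ a i) (μ b i) := by
      intro i
      simp only [z, Pi.smul_apply, Pi.sub_apply, Pi.add_apply, Pi.abs_apply, smul_eq_mul]
      rcases le_total (μ a i) (μ b i) with h | h
      · rw [min_eq_left h, abs_of_nonpos (by linarith)]; ring
      · rw [min_eq_right h, abs_of_nonneg (by linarith)]; ring
    have hzi : z i ≠ 0 := by
      rw [hzm]
      have h1 := lt_of_le_of_ne (hnn a i) ha.symm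
      have h2 := lt_of_le_of_ne (hnn b i) hb.symm
      exact (lt_min h1 h2).ne'
    have hz0 : z ≠ 0 := fun h => hzi (by simp [h])
    have hQ : Q (supp z) := ⟨z, hz, hz0, rfl⟩
    have hsa : supp z ⊆ a.1 := by
      intro i hi
      rw [← hsu a, hs]; rw [hs, hzm] at hi
      intro h; apply hi; rw [h]; exact min_eq_left (hnn b i)
    have hsb : supp z ⊆ b.1 := by
      intro i hi
      rw [← hsu b, hs]; rw [hs, hzm] at hi
      intro h; apply hi; rw [h]; exact min_eq_right (hnn a i)
    apply Subtype.ext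
    exact (le_antisymm (a.2.2 hQ hsa) hsa).trans (le_antisymm hsb (b.2.2 hQ hsb))
  have hni : ∀ a, ∃ i, μ a i ≠ 0 := fun a => Function.ne_iff.mp (hne a)
  refine ⟨J, inferInstance, μ, ?_, hK, hnn, hni, hdisj⟩
  choose p hp using hni
  let e : K →ₗ[ℝ] (J → ℝ) := (LinearMap.pi fun a => LinearMap.proj (p a)) ∘ₗ K.subtype
  have hinj : Function.Injective e := by
    rw [← LinearMap.ker_eq_bot, LinearMap.ker_eq_bot']
    rintro ⟨x, hx⟩ h0
    by_contra hxne
    have hx0 : x ≠ 0 := fun h => hxne (by simp [h])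
    obtain ⟨A, hA, hmin⟩ := exists_minimal_le_of_wellFoundedLT Q (supp x) ⟨x, hx, hx0, rfl⟩
    have h1 : p ⟨A, hmin⟩ ∈ supp x := by
      apply hA
      have := hp ⟨A, hmin⟩
      rwa [← hs, hsu] at this
    rw [hs] at h1
    apply h1
    exact congrFun h0 ⟨A, hmin⟩
  have := LinearMap.finrank_le_finrank_of_injective hinj
  simpa using this

lemma dS_chain {I : Type} [Fintype I] [Nonempty I] {V : Type} [AddCommGroup V] [Module ℝ V]
    [FiniteDimensional ℝ V] (S : I → Submodule ℝ V) (s : ℕ)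
    (hs : ∀ i, s ≤ Module.finrank ℝ (S i))
    (hcard : Module.finrank ℝ (⨆ i, S i : Submodule ℝ V) + 2 ≤ Fintype.card I + s) :
    ∃ i, S i ≤ ⨆ l, ⨆ (_ : l ≠ i), S l := by
  classical
  by_contra hcon
  push Not at hcon
  have key : ∀ A : Finset I, A.Nonempty →
      s + A.card ≤ Module.finrank ℝ (⨆ i ∈ A, S i : Submodule ℝ V) + 1 := by
    intro A hA
    induction hA using Finset.Nonempty.cons_induction with
    | singleton a =>
      have e : (⨆ i ∈ ({a} : Finset I), S i) = S a := by simp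
      rw [e]
      simpa using hs a
    | cons a A ha hA ih =>
      rw [Finset.card_cons, Finset.cons_eq_insert, Finset.iSup_insert]
      have hlt : (⨆ i ∈ A, S i) < S a ⊔ ⨆ i ∈ A, S i := by
        rw [right_lt_sup]
        intro h
        apply hcon a
        refine h.trans (iSup₂_le fun i hi => ?_)
        exact le_iSup₂_of_le i (fun h => ha (h ▸ hi)) le_rfl
      have := Submodule.finrank_lt_finrank_of_lt hlt
      omega
  have := key Finset.univ Finset.univ_nonempty
  have e : (⨆ i ∈ (Finset.univ : Finset I), S i) = ⨆ i, S i := by simp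
  rw [e, Finset.card_univ] at this
  omega

/-- The separation alternative for a configuration of flats. -/
lemma dS_alt {I : Type} [Fintype I] [DecidableEq I] {V : Type} [AddCommGroup V] [Module ℝ V]
    (w : I → V) (S : I → Submodule ℝ V) :
    (∃ (u : V) (l : I → I → ℝ), (∀ j i, i ≠ j → 0 < l j i) ∧ (∀ j, l j j = 0) ∧
      ∀ j, u - ∑ i, l j i • w i ∈ ⨆ i, ⨆ (_ : i ≠ j), S i) ∨
    ∃ ψ : I → V →ₗ[ℝ] ℝ, (∀ v, ∑ j, ψ j v = 0) ∧ (∀ j i, ∀ x ∈ S i, ψ j x = 0) ∧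
      (∀ j i, i ≠ j → 0 ≤ ψ j (w i)) ∧ ∃ j i, ψ j (w i) ≠ 0 := by
  let T : I → Submodule ℝ V := fun j => ⨆ i, ⨆ (_ : i ≠ j), S i
  let B : (I × I → ℝ) →ₗ[ℝ] (I → V) := LinearMap.pi fun j => ∑ i,
    if i = j then 0 else (LinearMap.proj (R := ℝ) (φ := fun _ : I × I => ℝ) (j, i)).smulRight (w i)
  have hB : ∀ l j, B l j = ∑ i, (if i = j then 0 else l (j, i)) • w i := by
    intro l j
    simp only [B, LinearMap.pi_apply, LinearMap.sum_apply]
    refine Finset.sum_congr rfl fun i _ => ?_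
    split_ifs <;> simp
  let U : Submodule ℝ (I → V) :=
    { carrier := {x | ∃ u, ∀ j, x j - u ∈ T j}
      add_mem' := by
        rintro x y ⟨u, hu⟩ ⟨v, hv⟩
        refine ⟨u + v, fun j => ?_⟩
        have := (T j).add_mem (hu j) (hv j)
        rw [Pi.add_apply]
        convert this using 1
        abel
      zero_mem' := ⟨0, fun j => by simp⟩
      smul_mem' := by
        rintro c x ⟨u, hu⟩
        refine ⟨c • u, fun j => ?_⟩
        have := (T j).smul_mem c (hu j)
        rwa [smul_sub] at this }
  have hU : ∀ x, x ∈ U ↔ ∃ u, ∀ j, x j - u ∈ T j := fun x => Iff.rfl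
  rcases dS_stiemke B U with ⟨l, hl, hlU⟩ | ⟨φ, hφU, hφp, l0, hl0⟩
  · left
    obtain ⟨u, hu⟩ := hlU
    refine ⟨u, fun j i => if i = j then 0 else l (j, i), ?_, ?_, ?_⟩
    · intro j i hij
      simp [hij, hl]
    · intro j; simp
    · intro j
      have := (T j).neg_mem (hu j)
      rw [hB, neg_sub] at this
      exact this
  · right
    have hsum : ∀ x : I → V, φ x = ∑ j, φ (Pi.single j (x j)) := by
      intro x
      rw [← map_sum, Finset.univ_sum_single]
    have hz : ∀ v, ∑ j, φ (Pi.single j v) = 0 := by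
      intro v
      rw [← hsum (fun _ => v)]
      exact hφU _ ⟨v, fun j => by simp⟩
    have hoff : ∀ j i, i ≠ j → ∀ x ∈ S i, φ (Pi.single j x) = 0 := by
      intro j i hij x hx
      apply hφU
      refine ⟨0, fun k => ?_⟩
      rw [sub_zero]
      by_cases hk : k = j
      · subst hk
        rw [Pi.single_eq_same]
        exact (le_iSup₂_of_le (f := fun i (_ : i ≠ k) => S i) i hij le_rfl) hx
      · rw [Pi.single_eq_of_ne hk]; exact Submodule.zero_mem _
    refine ⟨fun j => φ ∘ₗ LinearMap.single ℝ (fun _ => V) j, ?_, ?_, ?_, ?_⟩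
    · intro v; simpa using hz v
    · intro j i x hx
      simp only [LinearMap.comp_apply, LinearMap.single_apply]
      by_cases hij : i = j
      · subst hij
        have := hz x
        rw [Finset.sum_eq_single i] at this
        · exact this
        · intro b _ hb
          exact hoff b i hb.symm x hx
        · simp
      · exact hoff j i hij x hx
    · intro j i hij
      simp only [LinearMap.comp_apply, LinearMap.single_apply]
      have h1 := hφp (Pi.single (j, i) 1) (fun p => by
        by_cases h : p = (j, i)
        · subst h; simp
        · simp [h])
      have h2 : B (Pi.single (j, i) 1) = Pi.single j (w i) := by
        ext k
        rw [hB]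
        by_cases hk : k = j
        · subst hk
          rw [Pi.single_eq_same, Finset.sum_eq_single i]
          · simp [hij]
          · intro b _ hb
            simp [hb, Pi.single_apply]
          · simp
        · rw [Pi.single_eq_of_ne hk]
          apply Finset.sum_eq_zero
          intro b _
          simp [hk, Pi.single_apply]
      rwa [h2] at h1
    · by_contra hcon
      push Not at hcon
      simp only [LinearMap.comp_apply, LinearMap.single_apply] at hcon
      apply hl0
      rw [hsum]
      apply Finset.sum_eq_zero
      intro j _
      have : φ (Pi.single j (B l0 j)) = (φ ∘ₗ LinearMap.single ℝ (fun _ => V) j) (B l0 j) := rfl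
      rw [this, hB, map_sum]
      apply Finset.sum_eq_zero
      intro i _
      rw [map_smul, LinearMap.comp_apply, LinearMap.single_apply, hcon, smul_zero]

lemma dS_main (N : ℕ) : ∀ {I : Type} [Fintype I] [Nonempty I] {V : Type} [AddCommGroup V]
    [Module ℝ V] [FiniteDimensional ℝ V] (h : V →ₗ[ℝ] ℝ) (s : ℕ)
    (w : I → V) (S : I → Submodule ℝ V) (X : Submodule ℝ V)
    (_ : Module.finrank ℝ X = N)
    (_ : ∀ i, w i ∈ X) (_ : ∀ i, S i ≤ X) (_ : ∀ i, 0 < h (w i)) (_ : ∀ i, ∀ x ∈ S i, h x = 0)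
    (_ : ∀ i, s ≤ Module.finrank ℝ (S i))
    (_ : Module.finrank ℝ X + 1 ≤ Fintype.card I + s),
    ∃ (u : V) (L : Submodule ℝ V), s ≤ Module.finrank ℝ L ∧
      ∀ j, ∃ l : I → ℝ, (∀ i, 0 ≤ l i) ∧ (∃ i, l i ≠ 0) ∧ l j = 0 ∧
        (u - ∑ i, l i • w i ∈ ⨆ i, ⨆ (_ : l i ≠ 0), S i) ∧ L ≤ ⨆ i, ⨆ (_ : l i ≠ 0), S i := by
  induction N using Nat.strong_induction_on with
  | _ N IH =>
  intro I _ _ V _ _ _ h s w S X hN hwX hSX hw hS hs hcard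
  classical
  have hT : Module.finrank ℝ (⨆ i, S i : Submodule ℝ V) < Module.finrank ℝ X := by
    apply Submodule.finrank_lt_finrank_of_lt
    refine lt_of_le_of_ne (iSup_le hSX) ?_
    intro he
    obtain ⟨i⟩ := ‹Nonempty I›
    have h1 : (⨆ i, S i) ≤ LinearMap.ker h := iSup_le fun i x hx => hS i x hx
    have h2 : w i ∈ LinearMap.ker h := h1 (he ▸ hwX i)
    exact (hw i).ne' h2
  rcases dS_alt w S with ⟨u, l, hl, hl0, hu⟩ | ⟨ψ, hψs, hψS, hψp, j0, i0, hne⟩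
  · obtain ⟨i1, hi1⟩ := dS_chain S s hs (by omega)
    have hsup : ∀ j, (⨆ i, ⨆ (_ : l j i ≠ 0), S i) = ⨆ i, ⨆ (_ : i ≠ j), S i := by
      intro j
      have : ∀ i, (l j i ≠ 0) = (i ≠ j) := by
        intro i
        apply propext
        constructor
        · rintro h rfl; exact h (hl0 _)
        · intro h; exact (hl j i h).ne'
      simp_rw [this]
    refine ⟨u, S i1, hs i1, fun j => ⟨l j, ?_, ?_, hl0 j, ?_, ?_⟩⟩
    · intro i
      by_cases hij : i = j
      · subst hij; rw [hl0]
      · exact (hl j i hij).le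
    · have h1 : s ≤ Module.finrank ℝ (⨆ i, S i : Submodule ℝ V) :=
        (hs i1).trans (Submodule.finrank_mono (le_iSup S i1))
      have : 1 < Fintype.card I := by omega
      haveI := Fintype.one_lt_card_iff_nontrivial.mp this
      obtain ⟨i, hi⟩ := exists_ne j
      exact ⟨i, (hl j i hi).ne'⟩
    · rw [hsup]; exact hu j
    · rw [hsup]
      by_cases hj : i1 = j
      · subst hj; exact hi1
      · exact le_iSup₂_of_le (f := fun i (_ : i ≠ j) => S i) i1 hj le_rfl
  · let Ψ : V →ₗ[ℝ] (I → ℝ) := LinearMap.pi ψ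
    let Λ : (I → ℝ) →ₗ[ℝ] (I → ℝ) := Fintype.linearCombination ℝ (fun i => Ψ (w i))
    have hΛ : ∀ x, Λ x = Ψ (∑ i, x i • w i) := by
      intro x
      simp [Λ, Fintype.linearCombination_apply]
    have hΛj : ∀ x j, Λ x j = ∑ i, x i * ψ j (w i) := by
      intro x j
      rw [hΛ]
      simp [Ψ]
    have hΛs : ∀ x, ∑ j, Λ x j = 0 := by
      intro x
      rw [hΛ]; exact hψs _
    have habs : ∀ x ∈ LinearMap.ker Λ, |x| ∈ LinearMap.ker Λ := by
      intro x hx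
      rw [LinearMap.mem_ker] at hx ⊢
      have hnn : ∀ j, 0 ≤ Λ |x| j := by
        intro j
        have h1 : Λ x j = 0 := by rw [hx]; rfl
        rw [hΛj, ← Finset.add_sum_erase _ _ (Finset.mem_univ j)] at h1
        rw [hΛj, ← Finset.add_sum_erase _ _ (Finset.mem_univ j)]
        have hd : ψ j (w j) ≤ 0 := by
          have := hψs (w j)
          rw [← Finset.add_sum_erase _ _ (Finset.mem_univ j)] at this
          have h3 : 0 ≤ ∑ k ∈ Finset.univ.erase j, ψ k (w j) :=
            Finset.sum_nonneg fun k hk => hψp k j (Finset.ne_of_mem_erase hk).symm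
          linarith
        have h2 : |x j * ψ j (w j)| ≤ ∑ i ∈ Finset.univ.erase j, |x| i * ψ j (w i) := by
          have : x j * ψ j (w j) = - ∑ i ∈ Finset.univ.erase j, x i * ψ j (w i) := by linarith
          rw [this, abs_neg]
          refine (Finset.abs_sum_le_sum_abs _ _).trans (Finset.sum_le_sum fun i hi => ?_)
          rw [abs_mul, abs_of_nonneg (hψp j i (Finset.ne_of_mem_erase hi)), Pi.abs_apply]
        rw [abs_mul, abs_of_nonpos hd] at h2
        rw [Pi.abs_apply]
        simp only [Pi.abs_apply] at h2 ⊢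
        linarith
      funext j
      exact (Finset.sum_eq_zero_iff_of_nonneg (fun j _ => hnn j)).mp (hΛs _) j (Finset.mem_univ j)
    obtain ⟨J, _, μ, hJ, hμK, hμ0, hμne, hμd⟩ := dS_lattice (LinearMap.ker Λ) habs
    have hrn := LinearMap.finrank_range_add_finrank_ker Λ
    rw [Module.finrank_fintype_fun_eq_card] at hrn
    -- the range is proper
    have hrange : Module.finrank ℝ (LinearMap.range Λ) < Fintype.card I := by
      rw [← Module.finrank_fintype_fun_eq_card ℝ]
      apply Submodule.finrank_lt
      intro htop
      obtain ⟨i⟩ := ‹Nonempty I›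
      have : (Pi.single i 1 : I → ℝ) ∈ LinearMap.range Λ := htop ▸ Submodule.mem_top
      obtain ⟨x, hx⟩ := this
      have := hΛs x
      rw [hx] at this
      simp at this
    have hrpos : 0 < Module.finrank ℝ (LinearMap.range Λ) := by
      rw [Module.finrank_pos_iff_exists_ne_zero]
      refine ⟨⟨Λ (Pi.single i0 1), LinearMap.mem_range_self _ _⟩, ?_⟩
      intro h0
      have h1 : Λ (Pi.single i0 1) = 0 := congrArg Subtype.val h0
      have h2 := congrFun h1 j0
      rw [hΛj] at h2
      apply hne
      simpa [Pi.single_apply] using h2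
    haveI : Nonempty J := Fintype.card_pos_iff.mp (by omega)
    let X' : Submodule ℝ V := X ⊓ LinearMap.ker Ψ
    have hX' : Module.finrank ℝ X' + Module.finrank ℝ (LinearMap.range Λ)
        ≤ Module.finrank ℝ X := by
      have h1 := LinearMap.finrank_range_add_finrank_ker (Ψ.domRestrict X)
      have h2 : LinearMap.range Λ ≤ LinearMap.range (Ψ.domRestrict X) := by
        rintro _ ⟨x, rfl⟩
        refine ⟨⟨∑ i, x i • w i, X.sum_mem fun i _ => X.smul_mem _ (hwX i)⟩, ?_⟩
        rw [hΛ]; rfl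
      have h3 := Submodule.finrank_mono h2
      have h4 : Module.finrank ℝ (LinearMap.ker (Ψ.domRestrict X)) = Module.finrank ℝ X' := by
        have : X' = (LinearMap.ker (Ψ.domRestrict X)).map X.subtype := by
          ext v
          simp only [X', Submodule.mem_inf, LinearMap.mem_ker, Submodule.mem_map]
          constructor
          · rintro ⟨a, b⟩; exact ⟨⟨v, a⟩, b, rfl⟩
          · rintro ⟨⟨a, ha⟩, b, rfl⟩; exact ⟨ha, b⟩
        rw [this]
        exact (Submodule.finrank_map_subtype_eq _ _).symm
      omega
    have hSle : ∀ i, S i ≤ X' := fun i => le_inf (hSX i) fun x hx => by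
      rw [LinearMap.mem_ker]; funext j; exact hψS j i x hx
    obtain ⟨u, L, hL, hflat⟩ := IH (Module.finrank ℝ X') (by omega) (I := J) h s
      (fun a => ∑ i, μ a i • w i) (fun a => ⨆ i, ⨆ (_ : μ a i ≠ 0), S i) X' rfl
      (fun a => ⟨X.sum_mem fun i _ => X.smul_mem _ (hwX i), by
        have := hμK a
        rw [LinearMap.mem_ker, hΛ] at this
        exact this⟩)
      (fun a => iSup₂_le fun i _ => hSle i)
      (fun a => by
        rw [map_sum]
        obtain ⟨i, hi⟩ := hμne a
        refine Finset.sum_pos' (fun i _ => ?_) ⟨i, Finset.mem_univ i, ?_⟩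
        · rw [map_smul]; exact mul_nonneg (hμ0 a i) (hw i).le
        · rw [map_smul]; exact mul_pos (lt_of_le_of_ne (hμ0 a i) hi.symm) (hw i))
      (fun a x hx => by
        have : (⨆ i, ⨆ (_ : μ a i ≠ 0), S i) ≤ LinearMap.ker h :=
          iSup₂_le fun i _ x hx => hS i x hx
        exact this hx)
      (fun a => by
        obtain ⟨i, hi⟩ := hμne a
        exact (hs i).trans (Submodule.finrank_mono
          (le_iSup₂_of_le (f := fun i (_ : μ a i ≠ 0) => S i) i hi le_rfl)))
      (by omega)
    refine ⟨u, L, hL, fun j => ?_⟩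
    obtain ⟨a, ha⟩ : ∃ a, ∀ b, b ≠ a → μ b j = 0 := by
      by_cases hex : ∃ a, μ a j ≠ 0
      · obtain ⟨a, ha⟩ := hex
        refine ⟨a, fun b hb => ?_⟩
        by_contra hbj
        exact hb (hμd b a j hbj ha)
      · push Not at hex
        exact ⟨Classical.arbitrary J, fun b _ => hex b⟩
    obtain ⟨l, hl0, ⟨b0, hb0⟩, hla, hlu, hlL⟩ := hflat a
    have hnz : ∀ b i, l b ≠ 0 → μ b i ≠ 0 → ∑ b, l b * μ b i ≠ 0 := by
      intro b i hb hi
      apply ne_of_gt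
      refine Finset.sum_pos' (fun c _ => mul_nonneg (hl0 c) (hμ0 c i)) ⟨b, Finset.mem_univ b, ?_⟩
      exact mul_pos (lt_of_le_of_ne (hl0 b) hb.symm) (lt_of_le_of_ne (hμ0 b i) hi.symm)
    have hsup : (⨆ b, ⨆ (_ : l b ≠ 0), ⨆ i, ⨆ (_ : μ b i ≠ 0), S i) ≤
        ⨆ i, ⨆ (_ : ∑ b, l b * μ b i ≠ 0), S i := by
      refine iSup₂_le fun b hb => iSup₂_le fun i hi => ?_
      exact le_iSup₂_of_le (f := fun i (_ : ∑ b, l b * μ b i ≠ 0) => S i) i (hnz b i hb hi) le_rfl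
    refine ⟨fun i => ∑ b, l b * μ b i, ?_, ?_, ?_, ?_, ?_⟩
    · intro i
      exact Finset.sum_nonneg fun c _ => mul_nonneg (hl0 c) (hμ0 c i)
    · obtain ⟨i, hi⟩ := hμne b0
      exact ⟨i, hnz b0 i hb0 hi⟩
    · apply Finset.sum_eq_zero
      intro b _
      by_cases hb : b = a
      · subst hb; rw [hla, zero_mul]
      · rw [ha b hb, mul_zero]
    · apply hsup
      convert hlu using 2
      simp_rw [Finset.smul_sum, Finset.sum_smul, smul_smul]
      exact Finset.sum_comm
    · exact hlL.trans hsup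

lemma dS_step {I E : Type} [Fintype I] [Nonempty I] [AddCommGroup E] [Module ℝ E]
    [FiniteDimensional ℝ E] (s : ℕ) (C : I → Set E) (hC : ∀ i, Convex ℝ (C i))
    (hcard : Module.finrank ℝ E + 2 ≤ Fintype.card I + s)
    (u : I → E) (S : I → Submodule ℝ E) (hS : ∀ i, Module.finrank ℝ (S i) = s)
    (hsub : ∀ i j, j ≠ i → ∀ x ∈ S i, u i + x ∈ C j) :
    ∃ (v : E) (R : Submodule ℝ E), Module.finrank ℝ R = s ∧ ∀ j, ∀ x ∈ R, v + x ∈ C j := by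
  classical
  obtain ⟨p, L, hL, hflat⟩ := dS_main (Module.finrank ℝ (⊤ : Submodule ℝ (ℝ × E))) (I := I)
    (LinearMap.fst ℝ ℝ E) s (fun i => (1, u i)) (fun i => (S i).map (LinearMap.inr ℝ ℝ E)) ⊤ rfl
    (fun i => Submodule.mem_top) (fun i => le_top) (fun i => by simp)
    (fun i x hx => by
      obtain ⟨y, _, rfl⟩ := hx
      simp)
    (fun i => by
      rw [← hS i]
      exact (LinearEquiv.finrank_eq (Submodule.equivMapOfInjective _ LinearMap.inr_injective (S i))).le)
    (by
      rw [finrank_top, Module.finrank_prod, Module.finrank_self]; omega)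
  have hker : ∀ l : I → ℝ, (⨆ i, ⨆ (_ : l i ≠ 0), (S i).map (LinearMap.inr ℝ ℝ E)) ≤
      LinearMap.ker (LinearMap.fst ℝ ℝ E) := by
    intro l
    refine iSup₂_le fun i _ x hx => ?_
    obtain ⟨y, _, rfl⟩ := hx
    simp
  have hLk : L ≤ LinearMap.ker (LinearMap.fst ℝ ℝ E) := by
    obtain ⟨l, _, _, _, _, h⟩ := hflat (Classical.arbitrary I)
    exact h.trans (hker l)
  obtain ⟨b, hb⟩ := exists_linearIndependent_of_le_finrank hL
  have hb1 : ∀ i, (LinearMap.inr ℝ ℝ E) (b i).1.2 = (b i).1 := by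
    intro i
    have : (b i).1.1 = 0 := hLk (b i).2
    ext
    · simp [this]
    · simp
  have hb2 : LinearIndependent ℝ (fun i => (b i).1.2) := by
    apply LinearIndependent.of_comp (LinearMap.inr ℝ ℝ E)
    have : (LinearMap.inr ℝ ℝ E) ∘ (fun i => (b i).1.2) = L.subtype ∘ b := by
      funext i; exact hb1 i
    rw [this]
    exact hb.map' _ L.ker_subtype
  let R : Submodule ℝ E := Submodule.span ℝ (Set.range fun i => (b i).1.2)
  have hRL : ∀ x ∈ R, ((0 : ℝ), x) ∈ L := by
    have : R ≤ L.comap (LinearMap.inr ℝ ℝ E) := by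
      rw [Submodule.span_le]
      rintro _ ⟨i, rfl⟩
      change LinearMap.inr ℝ ℝ E (b i).1.2 ∈ L
      rw [hb1]; exact (b i).2
    exact this
  refine ⟨p.1⁻¹ • p.2, R, ?_, ?_⟩
  · rw [finrank_span_eq_card hb2, Fintype.card_fin]
  · intro j x hx
    obtain ⟨l, hl0, ⟨i1, hi1⟩, hlj, hlu, hlL⟩ := hflat j
    have hp1 : p.1 = ∑ i, l i := by
      have := hker l hlu
      simp [Prod.fst_sum] at this
      linarith
    have hpos : 0 < p.1 := by
      rw [hp1]
      exact Finset.sum_pos' (fun i _ => hl0 i)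
        ⟨i1, Finset.mem_univ _, lt_of_le_of_ne (hl0 i1) hi1.symm⟩
    have hmem := Submodule.add_mem _ hlu (hlL (L.smul_mem p.1 (hRL x hx)))
    have hfin : (⨆ i, ⨆ (_ : l i ≠ 0), (S i).map (LinearMap.inr ℝ ℝ E)) =
        ⨆ i ∈ Finset.univ.filter (fun i => l i ≠ 0), (S i).map (LinearMap.inr ℝ ℝ E) := by
      simp
    rw [hfin, Submodule.mem_iSup_finset_iff_exists_sum] at hmem
    obtain ⟨μ, hμ⟩ := hmem
    have hμS : ∀ i, (μ i).1.2 ∈ S i := by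
      intro i
      obtain ⟨y, hy, he⟩ := (μ i).2
      rw [← he]; exact hy
    have h2 := congrArg Prod.snd hμ
    simp only [Prod.snd_sum, Prod.snd_add, Prod.snd_sub, Prod.smul_snd] at h2
    have hsum : ∑ i, l i • u i = ∑ i ∈ Finset.univ.filter (fun i => l i ≠ 0), l i • u i := by
      symm
      apply Finset.sum_filter_of_ne
      intro i _ h h0
      apply h; rw [h0, zero_smul]
    have hx' : p.1⁻¹ • p.2 + x = ∑ i ∈ Finset.univ.filter (fun i => l i ≠ 0),
        (p.1⁻¹ * l i) • (u i + (l i)⁻¹ • (μ i).1.2) := by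
      have h3 : ∀ i ∈ Finset.univ.filter (fun i => l i ≠ 0),
          (p.1⁻¹ * l i) • (u i + (l i)⁻¹ • (μ i).1.2) = p.1⁻¹ • (l i • u i + (μ i).1.2) := by
        intro i hi
        rw [mul_smul, smul_add, smul_smul (l i), mul_inv_cancel₀ (Finset.mem_filter.mp hi).2,
          one_smul]
      rw [Finset.sum_congr rfl h3, ← Finset.smul_sum, Finset.sum_add_distrib, h2, hsum]
      have h4 : ∀ a b : E, a + (b - a + p.1 • x) = b + p.1 • x := by intro a b; abel
      rw [h4, smul_add, smul_smul, inv_mul_cancel₀ hpos.ne', one_smul]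
    rw [hx']
    apply (hC j).sum_mem
    · intro i _
      exact mul_nonneg (inv_nonneg.mpr hpos.le) (hl0 i)
    · rw [← Finset.mul_sum, Finset.sum_filter_ne_zero, ← hp1, inv_mul_cancel₀ hpos.ne']
    · intro i hi
      refine hsub i j ?_ _ ((S i).smul_mem _ (hμS i))
      rintro rfl
      exact (Finset.mem_filter.mp hi).2 hlj



/-- de Santis's theorem: if every subfamily of size at most `k+1` of a finite family of
convex sets in `ℝ^d` has an intersection containing a `(d-k)`-dimensional affine flat,
then so does the whole intersection. -/
theorem deSantis_flats (d k : ℕ) (hk1 : 1 ≤ k) (hkd : k ≤ d)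
    (𝒞 : Finset (Set (EuclideanSpace ℝ (Fin d))))
    (hconv : ∀ C ∈ 𝒞, Convex ℝ C)
    (H : ∀ 𝒞' ⊆ 𝒞, 𝒞'.card ≤ k + 1 →
      ∃ (u : EuclideanSpace ℝ (Fin d)) (S : Submodule ℝ (EuclideanSpace ℝ (Fin d))),
        Module.finrank ℝ S = d - k ∧
          (fun x => u + x) '' (S : Set (EuclideanSpace ℝ (Fin d))) ⊆
            ⋂₀ (𝒞' : Set (Set (EuclideanSpace ℝ (Fin d))))) :
    ∃ (u : EuclideanSpace ℝ (Fin d)) (S : Submodule ℝ (EuclideanSpace ℝ (Fin d))),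
      Module.finrank ℝ S = d - k ∧
        (fun x => u + x) '' (S : Set (EuclideanSpace ℝ (Fin d))) ⊆
          ⋂₀ (𝒞 : Set (Set (EuclideanSpace ℝ (Fin d)))) := by
  classical
  have key : ∀ n : ℕ, ∀ A ⊆ 𝒞, A.card = n →
      ∃ (u : EuclideanSpace ℝ (Fin d)) (S : Submodule ℝ (EuclideanSpace ℝ (Fin d))),
        Module.finrank ℝ S = d - k ∧
          (fun x => u + x) '' (S : Set (EuclideanSpace ℝ (Fin d))) ⊆
            ⋂₀ (A : Set (Set (EuclideanSpace ℝ (Fin d)))) := by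
    intro n
    induction n with
    | zero => intro A hA h0; exact H A hA (by omega)
    | succ n ih =>
      intro A hA hn
      by_cases hle : A.card ≤ k + 1
      · exact H A hA hle
      have hex : ∀ C : A, ∃ (u : EuclideanSpace ℝ (Fin d))
          (S : Submodule ℝ (EuclideanSpace ℝ (Fin d))), Module.finrank ℝ S = d - k ∧
          (fun x => u + x) '' (S : Set (EuclideanSpace ℝ (Fin d))) ⊆
            ⋂₀ ((A.erase C.1 : Finset _) : Set (Set (EuclideanSpace ℝ (Fin d)))) := by
        intro C
        refine ih _ ((Finset.erase_subset _ _).trans hA) ?_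
        rw [Finset.card_erase_of_mem C.2]; omega
      choose u S hS hsub using hex
      have hne : Nonempty A := by
        have : A.Nonempty := Finset.card_pos.mp (by omega)
        exact this.to_subtype
      obtain ⟨v, R, hR, hv⟩ := dS_step (I := A) (d - k) (fun C => C.1)
        (fun C => hconv C.1 (hA C.2))
        (by rw [finrank_euclideanSpace_fin, Fintype.card_coe]; omega) u S hS
        (by
          intro i j hij x hx
          refine hsub i ⟨x, hx, rfl⟩ j.1 ?_
          rw [Finset.mem_coe, Finset.mem_erase]
          exact ⟨fun h => hij (Subtype.ext h), j.2⟩)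
      refine ⟨v, R, hR, ?_⟩
      rintro _ ⟨x, hx, rfl⟩ C hC
      exact hv ⟨C, hC⟩ x hx
  exact key _ 𝒞 subset_rfl rfl
end

section
/- Let k ∈ [d], m(k,d) = max{d+1, 2(d−k+1)}, and let 𝒞 be a finite family of convex sets in ℝ^d. If for every subfamily 𝒞* ⊆ 𝒞 of size at most m(k,d) the intersection ⋂𝒞* contains a k-dimensional affine halfspace, then ⋂𝒞 contains a k-dimensional affine halfspace. -/
open scoped RealInnerProductSpace

open Module

set_option linter.unusedSectionVars false

def HS {E : Type*} [AddCommGroup E] [Module ℝ E] (k : ℕ) (C : Set E) : Prop :=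
  ∃ (u : E) (L : Submodule ℝ E) (v : E), finrank ℝ L + 1 = k ∧ v ∉ L ∧
    ∀ l ∈ L, ∀ t : ℝ, 0 ≤ t → u + l + t • v ∈ C

section
variable {E : Type*} [NormedAddCommGroup E] [NormedSpace ℝ E] [FiniteDimensional ℝ E]

lemma HS.mono {k : ℕ} {C D : Set E} (h : HS k C) (hCD : C ⊆ D) : HS k D := by
  obtain ⟨u, L, v, h1, h2, h3⟩ := h
  exact ⟨u, L, v, h1, h2, fun l hl t ht => hCD (h3 l hl t ht)⟩

lemma exists_sub (W : Submodule ℝ E) (m : ℕ) (h : m ≤ finrank ℝ W) :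
    ∃ L ≤ W, finrank ℝ L = m := by
  obtain ⟨f, hf⟩ := exists_linearIndependent_of_le_finrank h
  have hf' : LinearIndependent ℝ (fun i => W.subtype (f i)) :=
    hf.map' W.subtype (Submodule.ker_subtype W)
  refine ⟨Submodule.span ℝ (Set.range (fun i => W.subtype (f i))), ?_, ?_⟩
  · rw [Submodule.span_le]
    rintro _ ⟨i, rfl⟩
    exact (f i).2
  · rw [finrank_span_eq_card hf']; simp

lemma nonneg_of_ray {a b : ℝ} (h : ∀ t : ℝ, 0 ≤ a + t * b) : b = 0 := by
  by_contra hb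
  have := h ((-a - 1) / b)
  rw [div_mul_cancel₀ _ hb] at this
  linarith

/-- a nonzero functional nonneg on `C` is positive on the interior -/
lemma pos_of_interior {C : Set E} {f : E →ₗ[ℝ] ℝ} (hf : ∀ x ∈ C, 0 ≤ f x) (h : f ≠ 0)
    {x : E} (hx : x ∈ interior C) : 0 < f x := by
  obtain ⟨y, hy⟩ : ∃ y, f y ≠ 0 := by
    by_contra hh; push Not at hh; exact h (LinearMap.ext hh)
  have hcont : ContinuousAt (fun t : ℝ => x + t • y) 0 := by fun_prop
  have hmem : ∀ᶠ t : ℝ in nhds 0, x + t • y ∈ C :=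
    hcont (by simpa using mem_interior_iff_mem_nhds.1 hx)
  obtain ⟨ε, hε, hb⟩ := Metric.eventually_nhds_iff.1 hmem
  have h1 := hf _ (hb (y := ε / 2) (by simp [abs_of_pos hε]; linarith))
  have h2 := hf _ (hb (y := -(ε / 2)) (by simp [abs_of_pos hε]; linarith))
  simp at h1 h2
  rcases lt_or_gt_of_ne hy with h3 | h3
  · nlinarith
  · nlinarith

lemma sep {ι : Type*} [Fintype ι] (C : ι → Set E) (hc : ∀ i, Convex ℝ (C i))
    (h0 : ∀ i, (0 : E) ∈ C i) (hne : ∀ i, (interior (C i)).Nonempty)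
    (hemp : ¬ ∃ x, ∀ i, x ∈ interior (C i)) :
    ∃ f : ι → (E →ₗ[ℝ] ℝ), (∀ i, ∀ x ∈ C i, 0 ≤ f i x) ∧ ∑ i, f i = 0 ∧ ∃ i, f i ≠ 0 := by
  classical
  set A : Set (ι → E) := Set.pi Set.univ (fun i => interior (C i)) with hA
  set B : Set (ι → E) := Set.range (fun (x : E) (_ : ι) => x) with hB
  have hAc : Convex ℝ A := convex_pi (fun i _ => (hc i).interior)
  have hAo : IsOpen A := isOpen_set_pi Set.finite_univ (fun i _ => isOpen_interior)
  have hBc : Convex ℝ B := by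
    rintro _ ⟨x, rfl⟩ _ ⟨y, rfl⟩ a b _ _ _
    exact ⟨a • x + b • y, rfl⟩
  have hd : Disjoint A B := by
    rw [Set.disjoint_left]
    rintro _ hx ⟨y, rfl⟩
    exact hemp ⟨y, fun i => hx i trivial⟩
  obtain ⟨F, s, hFA, hFB⟩ := geometric_hahn_banach_open hAc hAo hBc hd
  have hFB0 : ∀ x : E, F (fun _ => x) = 0 := by
    intro x
    apply nonneg_of_ray (a := -s)
    intro t
    have := hFB (fun _ => t • x) ⟨t • x, rfl⟩
    have e : (fun _ : ι => t • x) = t • (fun _ : ι => x) := rfl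
    rw [e, map_smul, smul_eq_mul] at this
    linarith
  have hs : s ≤ 0 := by
    have := hFB (fun _ => 0) ⟨0, rfl⟩
    rwa [hFB0] at this
  have hneg : ∀ x ∈ A, F x < 0 := fun x hx => (hFA x hx).trans_le hs
  have hcl : ∀ x : ι → E, (∀ i, x i ∈ C i) → F x ≤ 0 := by
    intro x hx
    have hxA : x ∈ closure A := by
      rw [hA, closure_pi_set]
      intro i _
      show x i ∈ closure (interior (C i))
      rw [(hc i).closure_interior_eq_closure_of_nonempty_interior (hne i)]
      exact subset_closure (hx i)
    have : closure A ⊆ {x | F x ≤ 0} :=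
      closure_minimal (fun x hx => (hneg x hx).le) (isClosed_le F.continuous continuous_const)
    exact this hxA
  have hsum : ∀ x : ι → E, F x = ∑ i, F (Pi.single i (x i)) := by
    intro x
    rw [← map_sum, Finset.univ_sum_single]
  refine ⟨fun i => -(F.toLinearMap ∘ₗ LinearMap.single ℝ (fun _ => E) i), ?_, ?_, ?_⟩
  · intro i x hx
    have := hcl (Pi.single i x) (fun j => by
      by_cases h : j = i
      · subst h; simpa using hx
      · simp [h, h0])
    simpa using this
  · ext x
    have := hsum (fun _ => x)
    rw [hFB0] at this
    simp [LinearMap.sum_apply, Finset.sum_neg_distrib, ← this]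
  · by_contra hh
    push Not at hh
    choose x hx using hne
    have h1 := hneg x (fun i _ => hx i)
    rw [hsum] at h1
    have : ∀ i, F (Pi.single i (x i)) = 0 := by
      intro i
      have := congrArg (fun g : E →ₗ[ℝ] ℝ => g (x i)) (hh i)
      simpa using this
    simp [this] at h1

/-- linear independence of minimal dependency -/
lemma indep {ι : Type*} [Fintype ι] [DecidableEq ι] (C : ι → Set E)
    (hmin : ∀ S : Finset ι, S ≠ Finset.univ → ∃ x, ∀ i ∈ S, x ∈ interior (C i))
    (f : ι → (E →ₗ[ℝ] ℝ)) (hf : ∀ i, ∀ x ∈ C i, 0 ≤ f i x) (hs : ∑ i, f i = 0)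
    (hn : ∃ i, f i ≠ 0) (i₀ : ι) :
    LinearIndependent ℝ (fun i : {i // i ≠ i₀} => f i) := by
  -- key claim
  have key : ∀ b : ι → ℝ, (∀ i, 0 ≤ b i) → ∑ i, b i • f i = 0 → (∃ i, b i • f i = 0) →
      ∀ i, b i • f i = 0 := by
    intro b hb hsb ⟨j, hj⟩
    obtain ⟨x, hx⟩ := hmin (Finset.univ.erase j) (by
      intro h; have := Finset.mem_univ j; rw [← h] at this; simp at this)
    have hnn : ∀ i ∈ Finset.univ, 0 ≤ b i * f i x := by
      intro i _
      by_cases h : i = j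
      · subst h
        have := congrArg (fun g : E →ₗ[ℝ] ℝ => g x) hj
        simp only [LinearMap.smul_apply, smul_eq_mul, LinearMap.zero_apply] at this
        exact this.ge
      · exact mul_nonneg (hb i) (hf i x (interior_subset (hx i (by simp [h]))))
    have hz : ∑ i, b i * f i x = 0 := by
      have := congrArg (fun g : E →ₗ[ℝ] ℝ => g x) hsb
      simpa [LinearMap.sum_apply] using this
    rw [Finset.sum_eq_zero_iff_of_nonneg hnn] at hz
    intro i
    by_cases h : i = j
    · subst h; exact hj
    · by_contra hbf
      have hfi : f i ≠ 0 := fun h' => hbf (by simp [h'])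
      have hbi : b i ≠ 0 := fun h' => hbf (by simp [h'])
      have := pos_of_interior (hf i) hfi (hx i (by simp [h]))
      rcases mul_eq_zero.1 (hz i (Finset.mem_univ _)) with h' | h'
      · exact hbi h'
      · exact this.ne' h'
  have hall : ∀ i, f i ≠ 0 := by
    intro i hi
    obtain ⟨j, hj⟩ := hn
    have := key (fun _ => 1) (by simp) (by simpa using hs) ⟨i, by simpa using hi⟩ j
    exact hj (by simpa using this)
  rw [Fintype.linearIndependent_iff]
  intro g hg
  let a : ι → ℝ := fun i => if h : i ≠ i₀ then g ⟨i, h⟩ else 0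
  have ha : ∑ i, a i • f i = 0 := by
    have e := Finset.sum_subtype (Finset.univ.erase i₀) (p := fun i => i ≠ i₀)
      (F := inferInstance) (by simp)
      (fun i => a i • f i)
    rw [Finset.sum_erase _ (by simp [a])] at e
    rw [e, ← hg]
    apply Finset.sum_congr rfl
    intro i _
    simp [a, i.2]
  have : Nonempty ι := ⟨i₀⟩
  obtain ⟨m, hm⟩ := Finite.exists_min a
  have h1 := key (fun i => a i - a m) (fun i => sub_nonneg.2 (hm i))
    (by
      have e : ∀ i, (a i - a m) • f i = a i • f i - a m • f i := fun i => by
        ext x; simp [sub_mul]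
      rw [Finset.sum_congr rfl (fun i _ => e i), Finset.sum_sub_distrib, ha, ← Finset.smul_sum, hs]
      simp)
    ⟨m, by simp⟩
  have h2 : ∀ i, a i = a m := fun i => by
    rcases smul_eq_zero.1 (h1 i) with h | h
    · linarith
    · exact absurd h (hall i)
  intro i
  have h3 : a i = g i := by simp [a, i.2]
  have h4 : a i₀ = 0 := by simp [a]
  rw [← h3, h2, ← h2 i₀, h4]

lemma span_ne_top {C : Set E} (hc : Convex ℝ C) (h0 : (0 : E) ∈ C) (he : ¬ (interior C).Nonempty) :
    Submodule.span ℝ C ≠ ⊤ := by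
  intro h
  apply he
  rw [hc.interior_nonempty_iff_affineSpan_eq_top]
  have := affineSpan_insert_zero (k := ℝ) C
  rw [Set.insert_eq_of_mem h0] at this
  apply SetLike.coe_injective
  rw [this, h]; rfl

lemma red {ι : Type*} [Fintype ι] [DecidableEq ι] (C : ι → Set E) (hc : ∀ i, Convex ℝ (C i))
    (h0 : ∀ i, (0 : E) ∈ C i) (hemp : ¬ ∃ x, ∀ i, x ∈ interior (C i))
    (hmin : ∀ S : Finset ι, S ≠ Finset.univ → ∃ x, ∀ i ∈ S, x ∈ interior (C i))
    (k : ℕ) (hk1 : 1 ≤ k) (hkd : k ≤ finrank ℝ E)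
    (H : ∀ T : Finset ι, T.card ≤ 2 * (finrank ℝ E - k + 1) → HS k {x | ∀ i ∈ T, x ∈ C i}) :
    ∃ V : Submodule ℝ E, finrank ℝ V < finrank ℝ E ∧
      Fintype.card ι ≤ 2 * (finrank ℝ E - finrank ℝ V) ∧
      Fintype.card ι ≤ 2 * (finrank ℝ E - k + 1) ∧ ∀ x, (∀ i, x ∈ C i) → x ∈ V := by
  have hne : Nonempty ι := by
    by_contra h
    rw [not_nonempty_iff] at h
    exact hemp ⟨0, fun i => h.elim i⟩
  obtain ⟨i₀⟩ := hne
  by_cases hcard : Fintype.card ι ≤ 1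
  · have hsub := Fintype.card_le_one_iff_subsingleton.1 hcard
    have hlt : finrank ℝ (Submodule.span ℝ (C i₀)) < finrank ℝ E := by
      apply Submodule.finrank_lt
      apply span_ne_top (hc i₀) (h0 i₀)
      rintro ⟨x, hx⟩
      exact hemp ⟨x, fun i => by rwa [Subsingleton.elim i i₀]⟩
    refine ⟨Submodule.span ℝ (C i₀), hlt, by omega, by omega, fun x hx =>
      Submodule.subset_span (hx i₀)⟩
  · have hnei : ∀ i, (interior (C i)).Nonempty := by
      intro i
      obtain ⟨x, hx⟩ := hmin {i} (by
        intro h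
        have := congrArg Finset.card h
        simp at this
        omega)
      exact ⟨x, hx i (by simp)⟩
    obtain ⟨f, hf, hs, hn⟩ := sep C hc h0 hnei hemp
    have hli : LinearIndependent ℝ (fun i : {i // i ≠ i₀} => (f i : Module.Dual ℝ E)) :=
      indep C hmin f hf hs hn i₀
    set W : Submodule ℝ (Module.Dual ℝ E) := Submodule.span ℝ (Set.range (fun i : {i // i ≠ i₀} => (f i : Module.Dual ℝ E))) with hW
    have hWr : finrank ℝ W = Fintype.card ι - 1 := by
      rw [hW, finrank_span_eq_card hli]; simp
    have hV := Subspace.finrank_add_finrank_dualCoannihilator_eq W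
    refine ⟨W.dualCoannihilator, by omega, by omega, ?_, ?_⟩
    · by_contra hbig
      push Not at hbig
      obtain ⟨T, hT, hTc⟩ := Finset.exists_subset_card_eq (s := Finset.univ.erase i₀)
        (n := finrank ℝ E - k + 2) (by
          rw [Finset.card_erase_of_mem (Finset.mem_univ _), Finset.card_univ]; omega)
      obtain ⟨u, L, v, hL, hv, hin⟩ := H T (by omega)
      have hTi : ∀ i ∈ T, i ≠ i₀ := fun i hi => Finset.ne_of_mem_erase (hT hi)
      have hli' : LinearIndependent ℝ (fun i : T => (f i : Module.Dual ℝ E)) :=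
        hli.comp (fun i : T => (⟨i.1, hTi i.1 i.2⟩ : {i // i ≠ i₀})) (by
          intro a b h
          exact Subtype.ext (congrArg (fun z : {i // i ≠ i₀} => z.1) h))
      have hr := finrank_span_eq_card hli'
      have hle : L ≤ (Submodule.span ℝ (Set.range (fun i : T => (f i : Module.Dual ℝ E)))).dualCoannihilator := by
        intro l hl
        rw [Submodule.mem_dualCoannihilator]
        intro φ hφ
        induction hφ using Submodule.span_induction with
        | mem φ h =>
          obtain ⟨i, rfl⟩ := h
          apply nonneg_of_ray (a := f i u)
          intro t
          have := hf i _ (hin (t • l) (L.smul_mem t hl) 0 le_rfl i i.2)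
          simpa using this
        | zero => simp
        | add a b _ _ ha hb => simp [ha, hb]
        | smul a b _ hb => simp [hb]
      have h1 := Submodule.finrank_mono hle
      have h2 := Subspace.finrank_add_finrank_dualCoannihilator_eq
        (Submodule.span ℝ (Set.range (fun i : T => (f i : Module.Dual ℝ E))))
      rw [hr, Fintype.card_coe] at h2
      omega
    · intro x hx
      have hz : ∀ i, f i x = 0 := by
        have e : ∑ i, f i x = 0 := by
          have := congrArg (fun g : E →ₗ[ℝ] ℝ => g x) hs
          simpa [LinearMap.sum_apply] using this
        rw [Finset.sum_eq_zero_iff_of_nonneg (fun i _ => hf i x (hx i))] at e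
        exact fun i => e i (Finset.mem_univ _)
      rw [Submodule.mem_dualCoannihilator]
      intro φ hφ
      induction hφ using Submodule.span_induction with
      | mem φ h => obtain ⟨i, rfl⟩ := h; exact hz i
      | zero => simp
      | add a b _ _ ha hb => simp [ha, hb]
      | smul a b _ hb => simp [hb]

lemma HS.restrict {k : ℕ} {C : Set E} (V : Submodule ℝ E) (hCV : C ⊆ V) (h : HS k C) :
    HS k {x : V | (x : E) ∈ C} ∧ k ≤ finrank ℝ V := by
  obtain ⟨u, L, v, h1, h2, h3⟩ := h
  have hu : u ∈ V := hCV (by simpa using h3 0 L.zero_mem 0 le_rfl)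
  have hL : L ≤ V := by
    intro l hl
    have : u + l ∈ V := hCV (by simpa using h3 l hl 0 le_rfl)
    simpa using V.sub_mem this hu
  have hv : v ∈ V := by
    have : u + v ∈ V := hCV (by simpa using h3 0 L.zero_mem 1 zero_le_one)
    simpa using V.sub_mem this hu
  constructor
  · refine ⟨⟨u, hu⟩, L.comap V.subtype, ⟨v, hv⟩, ?_, ?_, ?_⟩
    · rw [(Submodule.comapSubtypeEquivOfLe hL).finrank_eq, h1]
    · simpa using h2
    · intro l hl t ht
      exact h3 l hl t ht
  · have : L < V := lt_of_le_of_ne hL (fun h => h2 (h ▸ hv))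
    have := Submodule.finrank_lt_finrank_of_lt this
    omega

lemma HS.unrestrict {k : ℕ} {C : Set E} (V : Submodule ℝ E) (h : HS k {x : V | (x : E) ∈ C}) :
    HS k C := by
  obtain ⟨u, L, v, h1, h2, h3⟩ := h
  refine ⟨u, L.map V.subtype, v, ?_, ?_, ?_⟩
  · rw [← h1, Submodule.finrank_map_subtype_eq]
  · rintro ⟨w, hw, hwv⟩
    have : w = v := Subtype.ext hwv
    exact h2 (this ▸ hw)
  · rintro _ ⟨l, hl, rfl⟩ t ht
    exact h3 l hl t ht

end

universe u w

def PP (n k : ℕ) : Prop :=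
  ∀ (E : Type u) [NormedAddCommGroup E] [NormedSpace ℝ E] [FiniteDimensional ℝ E]
    (ι : Type w) [Fintype ι] (C : ι → Set E), finrank ℝ E = n → k ≤ n →
    (∀ i, Convex ℝ (C i)) → (∀ i, (0 : E) ∈ C i) →
    (∀ T : Finset ι, T.card ≤ 2 * (n - k + 1) → HS k {x | ∀ i ∈ T, x ∈ C i}) →
    HS k {x | ∀ i, x ∈ C i}

lemma step_s19 {E : Type u} [NormedAddCommGroup E] [NormedSpace ℝ E] [FiniteDimensional ℝ E]
    {ι : Type w} [Fintype ι] (C : ι → Set E) (k : ℕ) (hk1 : 1 ≤ k) (hkd : k ≤ finrank ℝ E)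
    (IH : ∀ n' < finrank ℝ E, PP.{u, w} n' k)
    (hc : ∀ i, Convex ℝ (C i)) (h0 : ∀ i, (0 : E) ∈ C i)
    (H : ∀ T : Finset ι, T.card ≤ 2 * (finrank ℝ E - k + 1) → HS k {x | ∀ i ∈ T, x ∈ C i})
    (hemp : ¬ ∃ x, ∀ i, x ∈ interior (C i)) : HS k {x | ∀ i, x ∈ C i} := by
  classical
  obtain ⟨S, hS, hmin⟩ := (wellFounded_lt (α := Finset ι)).has_min
    {S | ¬ ∃ x, ∀ i ∈ S, x ∈ interior (C i)} ⟨Finset.univ, by simpa using hemp⟩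
  obtain ⟨V, hV1, hV2, hV3, hV4⟩ := red (fun i : S => C i) (fun i => hc i) (fun i => h0 i)
    (by
      rintro ⟨x, hx⟩
      exact hS ⟨x, fun i hi => hx ⟨i, hi⟩⟩)
    (by
      intro S' hS'
      by_contra hcon
      refine hmin (S'.map (Function.Embedding.subtype _)) ?_ ?_
      · rintro ⟨x, hx⟩
        exact hcon ⟨x, fun i hi => hx i (Finset.mem_map_of_mem (Function.Embedding.subtype _) hi)⟩
      · refine Finset.ssubset_iff_subset_ne.2 ⟨?_, ?_⟩
        · intro i hi
          obtain ⟨j, _, rfl⟩ := Finset.mem_map.1 hi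
          exact j.2
        · intro h
          have h1 := congrArg Finset.card h
          rw [Finset.card_map] at h1
          exact hS' ((Finset.card_eq_iff_eq_univ S').1 (by simpa using h1)))
    k hk1 hkd
    (by
      intro T hT
      refine (H (T.map (Function.Embedding.subtype _)) (by simpa using hT)).mono ?_
      intro x hx i hi
      exact hx i (Finset.mem_map_of_mem (Function.Embedding.subtype _) hi))
  simp only [Fintype.card_coe] at hV2 hV3
  have hsub : ∀ T : Finset ι, S ⊆ T → {x | ∀ i ∈ T, x ∈ C i} ⊆ (V : Set E) := by
    intro T hT x hx
    exact hV4 x (fun i => hx i (hT i.2))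
  have hkV := ((H S hV3).restrict V (hsub S subset_rfl)).2
  have key := IH (finrank ℝ V) hV1 V ι (fun i => {x : V | (x : E) ∈ C i ∧ ∀ j ∈ S, (x : E) ∈ C j})
    rfl hkV ?_ ?_ ?_
  · refine HS.unrestrict V (HS.mono key ?_)
    intro x hx i
    exact (hx i).1
  · intro i
    have h1 : Convex ℝ (C i ∩ ⋂ j ∈ S, C j) :=
      (hc i).inter (convex_iInter₂ (fun j _ => hc j))
    have h2 := h1.linear_preimage V.subtype
    have e : {x : V | (x : E) ∈ C i ∧ ∀ j ∈ S, (x : E) ∈ C j} =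
        V.subtype ⁻¹' (C i ∩ ⋂ j ∈ S, C j) := by
      ext x; simp
    show Convex ℝ {x : V | (x : E) ∈ C i ∧ ∀ j ∈ S, (x : E) ∈ C j}
    rw [e]
    exact h2
  · intro i
    exact ⟨h0 i, fun j _ => h0 j⟩
  · intro T hT
    have hcu := Finset.card_union_le T S
    have h1 := ((H (T ∪ S) (by omega)).restrict V (hsub _ Finset.subset_union_right)).1
    refine h1.mono ?_
    intro x hx i hi
    exact ⟨hx i (Finset.mem_union_left _ hi), fun j hj => hx j (Finset.mem_union_right _ hj)⟩

lemma greedy {E : Type*} [AddCommGroup E] [Module ℝ E] [FiniteDimensional ℝ E]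
    {ι : Type*} (Λ : ι → Submodule ℝ E) (m : ℕ) :
    ∃ T : Finset ι, T.card ≤ m ∧
      ((⨅ i ∈ T, Λ i) = ⨅ i, Λ i ∨ finrank ℝ ↥(⨅ i ∈ T, Λ i) + m ≤ finrank ℝ E) := by
  classical
  induction m with
  | zero => exact ⟨∅, by simp, Or.inr (by simpa using Submodule.finrank_le _)⟩
  | succ m ih =>
    obtain ⟨T, hT, h | h⟩ := ih
    · exact ⟨T, by omega, Or.inl h⟩
    · by_cases hh : ∀ i, (⨅ i ∈ T, Λ i) ≤ Λ i
      · exact ⟨T, by omega, Or.inl (le_antisymm (le_iInf hh)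
          (le_iInf₂ fun i _ => iInf_le _ i))⟩
      · push Not at hh
        obtain ⟨i, hi⟩ := hh
        refine ⟨insert i T, (Finset.card_insert_le _ _).trans (by omega), Or.inr ?_⟩
        have : (⨅ j ∈ insert i T, Λ j) < ⨅ j ∈ T, Λ j := by
          rw [Finset.iInf_insert]
          exact inf_lt_right.2 hi
        have := Submodule.finrank_lt_finrank_of_lt this
        omega

/-- the direction cone at `x` -/
lemma cone_mem {E : Type*} [NormedAddCommGroup E] [NormedSpace ℝ E] {C : Set E}
    (hc : Convex ℝ C) {x u v : E} (hx : x ∈ interior C) (h : ∀ t : ℝ, 0 ≤ t → u + t • v ∈ C) :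
    ∀ t : ℝ, 0 ≤ t → x + t • v ∈ C := by
  have hcont : ContinuousAt (fun t : ℝ => x + t • (x - u)) 0 := by fun_prop
  have hmem : ∀ᶠ t : ℝ in nhds 0, x + t • (x - u) ∈ C :=
    hcont (by simpa using mem_interior_iff_mem_nhds.1 hx)
  obtain ⟨ε, hε, hb⟩ := Metric.eventually_nhds_iff.1 hmem
  have h1 := hb (y := ε / 2) (by simp [abs_of_pos hε]; linarith)
  intro t ht
  set s := ε / 2 with hs
  have hs0 : 0 < s := by positivity
  have h2 := h (t * (1 + s) / s) (by positivity)
  have := hc h1 h2 (a := 1 / (1 + s)) (b := s / (1 + s)) (by positivity) (by positivity)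
    (by field_simp)
  convert this using 1
  simp only [smul_add, smul_sub, smul_smul]
  match_scalars <;> field_simp <;> ring

theorem mainPP (k : ℕ) (hk1 : 1 ≤ k) (n : ℕ) : PP.{u, w} n k := by
  induction n using Nat.strong_induction_on with
  | _ n IH =>
  intro E _ _ _ ι _ C hn hkn hc h0 H
  subst hn
  by_cases hint : ∃ x, ∀ i, x ∈ interior (C i)
  swap
  · exact step_s19 C k hk1 hkn IH hc h0 H hint
  obtain ⟨x, hx⟩ := hint
  set K : ι → Set E := fun i => {v | ∀ t : ℝ, 0 ≤ t → x + t • v ∈ C i} with hK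
  have hKc : ∀ i, Convex ℝ (K i) := by
    intro i v hv v' hv' a b ha hb hab t ht
    have := hc i (hv t ht) (hv' t ht) ha hb hab
    convert this using 1
    obtain rfl : b = 1 - a := by linarith
    module
  have hK0 : ∀ i, (0 : E) ∈ K i := by
    intro i t _
    simpa using interior_subset (hx i)
  have hKs : ∀ i, ∀ v ∈ K i, ∀ s : ℝ, 0 ≤ s → s • v ∈ K i := by
    intro i v hv s hs t ht
    rw [smul_smul]
    exact hv _ (mul_nonneg ht hs)
  have hKa : ∀ i, ∀ v ∈ K i, ∀ v' ∈ K i, v + v' ∈ K i := by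
    intro i v hv v' hv'
    have := hKs i _ (hKc i hv hv' (a := 1 / 2) (b := 1 / 2) (by norm_num) (by norm_num)
      (by norm_num)) 2 (by norm_num)
    convert this using 1
    module
  have hKH : ∀ T : Finset ι, T.card ≤ 2 * (finrank ℝ E - k + 1) →
      ∃ (L : Submodule ℝ E) (v : E), finrank ℝ L + 1 = k ∧ v ∉ L ∧
        ∀ l ∈ L, ∀ t : ℝ, 0 ≤ t → ∀ i ∈ T, l + t • v ∈ K i := by
    intro T hT
    obtain ⟨u, L, v, h1, h2, h3⟩ := H T hT
    refine ⟨L, v, h1, h2, ?_⟩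
    intro l hl t ht i hi
    refine cone_mem (hc i) (hx i) (u := u) ?_
    intro s hs
    have := h3 (s • l) (L.smul_mem s hl) (s * t) (mul_nonneg hs ht) i hi
    convert this using 1
    module
  have hfin : HS k {v | ∀ i, v ∈ K i} → HS k {v | ∀ i, v ∈ C i} := by
    rintro ⟨u, L, v, h1, h2, h3⟩
    refine ⟨x + u, L, v, h1, h2, ?_⟩
    intro l hl t ht i
    have := h3 l hl t ht i 1 zero_le_one
    convert this using 1
    module
  apply hfin
  by_cases hintK : ∃ w, ∀ i, w ∈ interior (K i)
  swap
  · refine step_s19 K k hk1 hkn IH hKc hK0 ?_ hintK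
    intro T hT
    obtain ⟨L, v, h1, h2, h3⟩ := hKH T hT
    exact ⟨0, L, v, h1, h2, fun l hl t ht i hi => by simpa using h3 l hl t ht i hi⟩
  obtain ⟨w, hw⟩ := hintK
  let Λ : ι → Submodule ℝ E := fun i =>
    { carrier := {v | v ∈ K i ∧ -v ∈ K i}
      zero_mem' := by simpa using hK0 i
      add_mem' := by
        rintro a b ⟨ha, ha'⟩ ⟨hb, hb'⟩
        refine ⟨hKa i _ ha _ hb, ?_⟩
        rw [neg_add]
        exact hKa i _ ha' _ hb'
      smul_mem' := by
        rintro c v ⟨hv, hv'⟩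
        rcases le_total 0 c with h | h
        · refine ⟨hKs i _ hv c h, ?_⟩
          rw [← smul_neg]
          exact hKs i _ hv' c h
        · have h' : 0 ≤ -c := by linarith
          refine ⟨?_, ?_⟩
          · have := hKs i _ hv' (-c) h'
            simpa using this
          · have := hKs i _ hv (-c) h'
            simpa using this }
  have hΛm : ∀ i v, v ∈ Λ i ↔ v ∈ K i ∧ -v ∈ K i := fun i v => Iff.rfl
  have hΛT : ∀ T : Finset ι, T.card ≤ 2 * (finrank ℝ E - k + 1) →
      k ≤ finrank ℝ ↥(⨅ i ∈ T, Λ i) + 1 := by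
    intro T hT
    obtain ⟨L, v, h1, h2, h3⟩ := hKH T hT
    have : L ≤ ⨅ i ∈ T, Λ i := by
      refine le_iInf₂ fun i hi l hl => ?_
      rw [hΛm]
      refine ⟨?_, ?_⟩
      · simpa using h3 l hl 0 le_rfl i hi
      · simpa using h3 (-l) (L.neg_mem hl) 0 le_rfl i hi
    have := Submodule.finrank_mono this
    omega
  have hΛ : k ≤ finrank ℝ ↥(⨅ i, Λ i) + 1 := by
    obtain ⟨T, hT, h | h⟩ := greedy Λ (finrank ℝ E - k + 2)
    · rw [← h]
      exact hΛT T (by omega)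
    · have := hΛT T (by omega)
      omega
  obtain ⟨L, hL, hLr⟩ := exists_sub (⨅ i, Λ i) (k - 1) (by omega)
  have hLK : ∀ l ∈ L, ∀ i, l ∈ K i := fun l hl i =>
    ((hΛm i l).1 ((Submodule.mem_iInf _).1 (hL hl) i)).1
  obtain ⟨v, hvL, hvK⟩ : ∃ v, v ∉ L ∧ ∀ i, v ∈ K i := by
    by_cases hwL : w ∈ L
    swap
    · exact ⟨w, hwL, fun i => interior_subset (hw i)⟩
    have hall : ∀ i, ∀ y, y ∈ K i := by
      intro i y
      have hw' : -w ∈ K i := ((hΛm i w).1 ((Submodule.mem_iInf _).1 (hL hwL) i)).2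
      have hcont : ContinuousAt (fun t : ℝ => w + t • y) 0 := by fun_prop
      have hmem : ∀ᶠ t : ℝ in nhds 0, w + t • y ∈ K i :=
        hcont (by simpa using mem_interior_iff_mem_nhds.1 (hw i))
      obtain ⟨ε, hε, hb⟩ := Metric.eventually_nhds_iff.1 hmem
      have h1 := hb (y := ε / 2) (by simp [abs_of_pos hε]; linarith)
      have h2 := hKs i _ (hKa i _ h1 _ hw') (2 / ε) (by positivity)
      convert h2 using 1
      match_scalars <;> field_simp <;> ring
    have hlt : L ≠ ⊤ := by
      intro h
      rw [h, finrank_top] at hLr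
      omega
    obtain ⟨v, hv⟩ : ∃ v, v ∉ L := by
      by_contra hcon
      push Not at hcon
      exact hlt (Submodule.eq_top_iff'.2 hcon)
    exact ⟨v, hv, fun i => hall i v⟩
  refine ⟨0, L, v, by omega, hvL, ?_⟩
  intro l hl t ht i
  rw [zero_add]
  exact hKa i _ (hLK l hl i) _ (hKs i _ (hvK i) t ht)

section
variable {E : Type*} [NormedAddCommGroup E] [InnerProductSpace ℝ E] [FiniteDimensional ℝ E]

lemma HS_of {k : ℕ} {C : Set E}
    (h : ∃ (u : E) (T : Submodule ℝ E) (a : E), finrank ℝ T = k ∧ a ∈ T ∧ a ≠ 0 ∧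
      (fun x => u + x) '' {x ∈ (T : Set E) | 0 ≤ ⟪a, x⟫} ⊆ C) : HS k C := by
  obtain ⟨u, T, a, h1, h2, h3, h4⟩ := h
  refine ⟨u, (ℝ ∙ a)ᗮ ⊓ T, a, ?_, ?_, ?_⟩
  · have hle : (ℝ ∙ a) ≤ T := by
      rw [Submodule.span_singleton_le_iff_mem]; exact h2
    have := Submodule.finrank_add_inf_finrank_orthogonal hle
    rw [finrank_span_singleton h3] at this
    omega
  · intro h
    have := Submodule.mem_orthogonal_singleton_iff_inner_right.1 h.1
    exact h3 (inner_self_eq_zero.1 this)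
  · intro l hl t ht
    apply h4
    refine ⟨l + t • a, ⟨T.add_mem hl.2 (T.smul_mem t h2), ?_⟩, by simp [add_assoc]⟩
    have := Submodule.mem_orthogonal_singleton_iff_inner_right.1 hl.1
    rw [inner_add_right, this, inner_smul_right, zero_add]
    exact mul_nonneg ht real_inner_self_nonneg

lemma of_HS {k : ℕ} {C : Set E} (h : HS k C) :
    ∃ (u : E) (T : Submodule ℝ E) (a : E), finrank ℝ T = k ∧ a ∈ T ∧ a ≠ 0 ∧
      (fun x => u + x) '' {x ∈ (T : Set E) | 0 ≤ ⟪a, x⟫} ⊆ C := by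
  obtain ⟨u, L, v, h1, h2, h3⟩ := h
  set a := v - L.starProjection v with ha
  have haL : ∀ l ∈ L, ⟪a, l⟫ = 0 := fun l hl => L.starProjection_inner_eq_zero v l hl
  have hpL : L.starProjection v ∈ L := L.starProjection_apply_mem v
  have ha0 : a ≠ 0 := by
    intro h
    rw [ha, sub_eq_zero] at h
    exact h2 (h ▸ hpL)
  have haa : ⟪a, v⟫ = ⟪a, a⟫ := by
    conv_rhs => rw [ha, inner_sub_right, ← ha, haL _ hpL, sub_zero]
  have hvT : v ∈ L ⊔ (ℝ ∙ v) := Submodule.mem_sup_right (Submodule.mem_span_singleton_self v)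
  refine ⟨u, L ⊔ (ℝ ∙ v), a, ?_, ?_, ha0, ?_⟩
  · have hd := Submodule.finrank_sup_add_finrank_inf_eq L (ℝ ∙ v)
    have hv0 : v ≠ 0 := fun h => h2 (h ▸ L.zero_mem)
    have hdis : L ⊓ (ℝ ∙ v) = ⊥ := by
      rw [eq_bot_iff]
      rintro x ⟨hx, hx'⟩
      obtain ⟨c, rfl⟩ := Submodule.mem_span_singleton.1 hx'
      by_cases hc : c = 0
      · simp [hc]
      · exact absurd ((L.smul_mem_iff hc).1 hx) h2
    rw [hdis, finrank_bot, finrank_span_singleton hv0] at hd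
    omega
  · exact Submodule.sub_mem _ hvT (Submodule.mem_sup_left hpL)
  · rintro _ ⟨x, ⟨hx, hax⟩, rfl⟩
    obtain ⟨l, hl, y, hy, rfl⟩ := Submodule.mem_sup.1 hx
    obtain ⟨t, rfl⟩ := Submodule.mem_span_singleton.1 hy
    rw [inner_add_right, haL l hl, inner_smul_right, zero_add, haa] at hax
    have hpos : 0 < ⟪a, a⟫ := real_inner_self_pos.2 ha0
    have ht : 0 ≤ t := by
      by_contra hcon
      push Not at hcon
      nlinarith
    have := h3 l hl t ht
    simpa [add_assoc] using this

lemma HS.translate {k : ℕ} {C D : Set E} (p : E) (h : HS k C) (hCD : ∀ x ∈ C, x + p ∈ D) :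
    HS k D := by
  obtain ⟨u, L, v, h1, h2, h3⟩ := h
  refine ⟨u + p, L, v, h1, h2, fun l hl t ht => ?_⟩
  have := hCD _ (h3 l hl t ht)
  convert this using 1
  abel
end

/-- Kołodziejczyk's theorem: Helly-type theorem for `k`-dimensional affine halfspaces
with bound `m(k,d) = max {d+1, 2(d-k+1)}`. -/
theorem kolodziejczyk_affine_halfspace (d k : ℕ) (hk1 : 1 ≤ k) (hkd : k ≤ d)
    (𝒞 : Finset (Set (EuclideanSpace ℝ (Fin d))))
    (hconv : ∀ C ∈ 𝒞, Convex ℝ C)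
    (H : ∀ 𝒞' ⊆ 𝒞, 𝒞'.card ≤ max (d + 1) (2 * (d - k + 1)) →
      ∃ (u : EuclideanSpace ℝ (Fin d)) (T : Submodule ℝ (EuclideanSpace ℝ (Fin d)))
        (a : EuclideanSpace ℝ (Fin d)), Module.finrank ℝ T = k ∧ a ∈ T ∧ a ≠ 0 ∧
          (fun x => u + x) '' {x ∈ (T : Set (EuclideanSpace ℝ (Fin d))) | 0 ≤ ⟪a, x⟫} ⊆
            ⋂₀ (𝒞' : Set (Set (EuclideanSpace ℝ (Fin d))))) :
    ∃ (u : EuclideanSpace ℝ (Fin d)) (T : Submodule ℝ (EuclideanSpace ℝ (Fin d)))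
      (a : EuclideanSpace ℝ (Fin d)), Module.finrank ℝ T = k ∧ a ∈ T ∧ a ≠ 0 ∧
        (fun x => u + x) '' {x ∈ (T : Set (EuclideanSpace ℝ (Fin d))) | 0 ≤ ⟪a, x⟫} ⊆
          ⋂₀ (𝒞 : Set (Set (EuclideanSpace ℝ (Fin d)))) := by
  classical
  have Hp : (⋂₀ (𝒞 : Set (Set (EuclideanSpace ℝ (Fin d))))).Nonempty := by
    apply Convex.helly_theorem_set' (𝕜 := ℝ) hconv
    intro G hG hGc
    rw [finrank_euclideanSpace_fin] at hGc
    obtain ⟨u, L, v, _, _, h3⟩ := HS_of (H G hG (hGc.trans (le_max_left _ _)))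
    exact ⟨_, h3 0 L.zero_mem 0 le_rfl⟩
  obtain ⟨p, hp⟩ := Hp
  apply of_HS
  have key := mainPP k hk1 d (EuclideanSpace ℝ (Fin d)) 𝒞
    (fun C => {x | x + p ∈ (C : Set (EuclideanSpace ℝ (Fin d)))}) (by simp) hkd
    (fun C => (hconv C.1 C.2).translate_preimage_left p)
    (fun C => by simpa using hp C.1 C.2)
    (by
      intro T hT
      have h1 := HS_of (H (T.map (Function.Embedding.subtype _)) (by
          intro C hC
          obtain ⟨j, _, rfl⟩ := Finset.mem_map.1 hC
          exact j.2)
        (by rw [Finset.card_map]; exact hT.trans (le_max_right _ _)))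
      refine h1.translate (-p) ?_
      intro x hx C hC
      have := hx C (Finset.mem_coe.2 (Finset.mem_map_of_mem (Function.Embedding.subtype _) hC))
      simpa using this)
  refine key.translate p ?_
  intro x hx C hC
  exact hx ⟨C, hC⟩
end
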